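/- arXiv:1901.03997 — 8 statements merged into one kernel-verified Lean document; each statement's English description precedes it below -/
import Mathlib

section
/- For every real k > 0 there exists a constant C = C(k) such that for all real numbers x and Λ and all real numbers a, b with 0 < a ≤ b, one has |∫_a^b sin(x·η + Λ/η^k) / η dη| ≤ C. -/
open intervalIntegral Real

/-- A Van der Corput type estimate: if `h η = η * φ' η` and `(|sin φ|/η + |h'|)/(1 + h²)` is
dominated by the derivative of `G`, then the integral of `sin φ/η` over `[a, b]` is at most
`1 + (G b - G a)` in absolute value. -/
theorem abs_integral_sin_div_le_of_hasDerivAt {φ h h' G G' : ℝ → ℝ} {a b : ℝ} (ha : 0 < a)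
    (hab : a ≤ b) (hφ : ∀ η, 0 < η → HasDerivAt φ (h η / η) η)
    (hh : ∀ η, 0 < η → HasDerivAt h (h' η) η) (hG : ∀ η, 0 < η → HasDerivAt G (G' η) η)
    (hbound : ∀ η, 0 < η → (|sin (φ η)| / η + |h' η|) / (1 + h η ^ 2) ≤ G' η) :
    |∫ η in a..b, sin (φ η) / η| ≤ 1 + (G b - G a) := by
  set F : ℝ → ℝ := fun η => -cos (φ η) * (h η / (1 + h η ^ 2)) with hF
  set E : ℝ → ℝ := fun η =>
    (sin (φ η) / η + cos (φ η) * (h' η * ((1 - h η ^ 2) / (1 + h η ^ 2)))) / (1 + h η ^ 2) with hE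
  have hFd : ∀ η, 0 < η → HasDerivAt F (sin (φ η) / η - E η) η := by
    intro η hη
    have h1 : (1 + h η ^ 2) ≠ 0 := by positivity
    have hd := ((hφ η hη).cos.neg).mul ((hh η hη).div (((hh η hη).pow 2).const_add 1) h1)
    refine hd.congr_deriv ?_
    simp only [hE]
    simp
    field_simp
    ring
  have hEb : ∀ η, 0 < η → |E η| ≤ G' η := by
    intro η hη
    refine le_trans ?_ (hbound η hη)
    have h1 : 0 < 1 + h η ^ 2 := by positivity
    have hq : |(1 - h η ^ 2) / (1 + h η ^ 2)| ≤ 1 := by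
      rw [abs_div, abs_of_pos h1, div_le_one h1, abs_le]
      constructor <;> nlinarith [sq_nonneg (h η)]
    simp only [hE]
    rw [abs_div, abs_of_pos h1]
    gcongr
    refine (abs_add_le _ _).trans ?_
    rw [abs_div, abs_of_pos hη, abs_mul, abs_mul]
    gcongr
    calc |cos (φ η)| * (|h' η| * |(1 - h η ^ 2) / (1 + h η ^ 2)|)
        ≤ 1 * (|h' η| * 1) := by gcongr; exact abs_cos_le_one _
      _ = |h' η| := by ring
  have hFb : ∀ η, |F η| ≤ 1 / 2 := by
    intro η
    have h1 : 0 < 1 + h η ^ 2 := by positivity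
    have hq : |h η / (1 + h η ^ 2)| ≤ 1 / 2 := by
      rw [abs_div, abs_of_pos h1, div_le_iff₀ h1, ← sq_abs]
      nlinarith [sq_nonneg (|h η| - 1)]
    simp only [hF]
    rw [abs_mul, abs_neg]
    calc |cos (φ η)| * |h η / (1 + h η ^ 2)| ≤ 1 * (1 / 2) := by
          gcongr; exact abs_cos_le_one _
      _ = 1 / 2 := by ring
  have hpos : ∀ η ∈ Set.Icc a b, 0 < η := fun η hη => ha.trans_le hη.1
  have hpos' : ∀ η ∈ Set.Ioo a b, 0 < η := fun η hη => ha.trans hη.1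
  have hint : MeasureTheory.IntegrableOn (fun η => sin (φ η) / η) (Set.Icc a b) := by
    refine ContinuousOn.integrableOn_Icc fun η hη => ?_
    exact ((hφ η (hpos η hη)).sin.continuousAt.div continuousAt_id
      (hpos η hη).ne').continuousWithinAt
  have hup := integral_le_sub_of_hasDeriv_right_of_le (g := fun η => F η + G η) hab
    (fun η hη => ((hFd η (hpos η hη)).add (hG η (hpos η hη))).continuousAt.continuousWithinAt)
    (fun η hη => ((hFd η (hpos' η hη)).add (hG η (hpos' η hη))).hasDerivWithinAt) hint
    (fun η hη => by linarith [(abs_le.1 (hEb η (hpos' η hη))).2])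
  have hlo := sub_le_integral_of_hasDeriv_right_of_le (g := fun η => F η - G η) hab
    (fun η hη => ((hFd η (hpos η hη)).sub (hG η (hpos η hη))).continuousAt.continuousWithinAt)
    (fun η hη => ((hFd η (hpos' η hη)).sub (hG η (hpos' η hη))).hasDerivWithinAt) hint
    (fun η hη => by linarith [(abs_le.1 (hEb η (hpos' η hη))).1])
  have hFa := abs_le.1 (hFb a)
  have hFb' := abs_le.1 (hFb b)
  rw [abs_le]
  constructor <;> linarith [hFa.1, hFa.2, hFb'.1, hFb'.2]

theorem hasDerivAt_const_div_rpow (c k : ℝ) {η : ℝ} (hη : 0 < η) :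
    HasDerivAt (fun t : ℝ => c / t ^ k) (-(k * (c / η ^ k)) / η) η := by
  have hp : 0 < η ^ k := rpow_pos_of_pos hη k
  refine ((hasDerivAt_const η c).div (hasDerivAt_rpow_const (p := k) (Or.inl hη.ne'))
    hp.ne').congr_deriv ?_
  rw [rpow_sub_one hη.ne']
  field_simp
  ring

/-- The bound for a nonnegative linear coefficient `x`. -/
theorem abs_integral_sin_phase_div_le_of_nonneg {k : ℝ} (hk : 0 < k) {x : ℝ} (hx : 0 ≤ x)
    (Λ : ℝ) {a b : ℝ} (ha : 0 < a) (hab : a ≤ b) :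
    |∫ η in a..b, sin (x * η + Λ / η ^ k) / η| ≤ 1 + (2 + (1 + k ^ 2) / k ^ 2) * π := by
  have hlin : ∀ η : ℝ, HasDerivAt (fun t => x * t) x η := fun η => by
    simpa using (hasDerivAt_id η).const_mul x
  have hφ : ∀ η, 0 < η → HasDerivAt (fun t => x * t + Λ / t ^ k)
      ((x * η - k * (Λ / η ^ k)) / η) η := fun η hη => by
    refine ((hlin η).add (hasDerivAt_const_div_rpow Λ k hη)).congr_deriv ?_
    field_simp
    ring
  have hh : ∀ η, 0 < η → HasDerivAt (fun t => x * t - k * (Λ / t ^ k))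
      ((x * η + k ^ 2 * (Λ / η ^ k)) / η) η := fun η hη => by
    refine ((hlin η).sub ((hasDerivAt_const_div_rpow Λ k hη).const_mul k)).congr_deriv ?_
    field_simp
    ring
  have hnum : ∀ η, 0 < η → |sin (x * η + Λ / η ^ k)| / η + |(x * η + k ^ 2 * (Λ / η ^ k)) / η| ≤
      (2 * (x * η) + (1 + k ^ 2) * |Λ / η ^ k|) / η := fun η hη => by
    rw [abs_div, abs_of_pos hη, ← add_div]
    refine div_le_div_of_nonneg_right ?_ hη.le
    have hA : 0 ≤ x * η := by positivity
    have h1 := (abs_sin_le_abs (x := x * η + Λ / η ^ k)).trans (abs_add_le _ _)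
    have h2 := abs_add_le (x * η) (k ^ 2 * (Λ / η ^ k))
    rw [abs_mul (k ^ 2), abs_of_nonneg (sq_nonneg k)] at h2
    rw [abs_of_nonneg hA] at h1 h2
    linarith
  have hK : (1 + k ^ 2) / k ^ 2 * k ^ 2 = 1 + k ^ 2 := by field_simp
  have hK0 : 0 < (1 + k ^ 2) / k ^ 2 := by positivity
  set K := (1 + k ^ 2) / k ^ 2
  rcases le_total 0 Λ with hΛ | hΛ
  · refine (abs_integral_sin_div_le_of_hasDerivAt ha hab hφ hh
      (fun η hη => ((hh η hη).arctan.const_mul (2 + K))) fun η hη => ?_).trans ?_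
    · have hB : 0 ≤ Λ / η ^ k := div_nonneg hΛ (rpow_pos_of_pos hη k).le
      have hA : 0 ≤ x * η := by positivity
      have hn := hnum η hη
      rw [abs_of_nonneg hB] at hn
      calc _ ≤ ((2 + K) * ((x * η + k ^ 2 * (Λ / η ^ k)) / η)) /
            (1 + (x * η - k * (Λ / η ^ k)) ^ 2) := by
            gcongr
            refine hn.trans ?_
            rw [← mul_div_assoc (2 + K)]
            refine div_le_div_of_nonneg_right ?_ hη.le
            nlinarith [mul_nonneg hK0.le hA, mul_nonneg (sq_nonneg k) hB]
        _ = _ := by ring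
    · have h1 := neg_pi_div_two_lt_arctan (x * a - k * (Λ / a ^ k))
      have h2 := arctan_lt_pi_div_two (x * b - k * (Λ / b ^ k))
      nlinarith
  · have hA' : ∀ η, 0 < η → HasDerivAt (fun t => k * (Λ / t ^ k))
        (k * (-(k * (Λ / η ^ k)) / η)) η := fun η hη =>
      (hasDerivAt_const_div_rpow Λ k hη).const_mul k
    refine (abs_integral_sin_div_le_of_hasDerivAt ha hab hφ hh
      (fun η hη => ((hlin η).arctan.const_mul 2).add ((hA' η hη).arctan.const_mul K))
      fun η hη => ?_).trans ?_
    · have hB : Λ / η ^ k ≤ 0 := div_nonpos_of_nonpos_of_nonneg hΛ (rpow_pos_of_pos hη k).le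
      have hA : 0 ≤ x * η := by positivity
      have hn := hnum η hη
      rw [abs_of_nonpos hB] at hn
      set B := Λ / η ^ k
      have hAB : 0 ≤ x * η * (k * -B) := mul_nonneg hA (mul_nonneg hk.le (neg_nonneg.2 hB))
      have hB' : 0 ≤ -B := neg_nonneg.2 hB
      calc _ ≤ ((2 * (x * η) + (1 + k ^ 2) * -B) / η) / (1 + (x * η - k * B) ^ 2) := by gcongr
        _ = 2 * (x * η / η) / (1 + (x * η - k * B) ^ 2) +
            (1 + k ^ 2) * (-B / η) / (1 + (x * η - k * B) ^ 2) := by ring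
        _ ≤ 2 * (x * η / η) / (1 + (x * η) ^ 2) +
            (1 + k ^ 2) * (-B / η) / (1 + (k * B) ^ 2) := by
            gcongr 2 * (x * η / η) / ?_ + (1 + k ^ 2) * (-B / η) / ?_
            · nlinarith [sq_nonneg (k * B)]
            · nlinarith [sq_nonneg (x * η)]
        _ = _ := by
            rw [← hK]
            field_simp
    · have h1 := neg_pi_div_two_lt_arctan (x * a)
      have h2 := arctan_lt_pi_div_two (x * b)
      have h3 := neg_pi_div_two_lt_arctan (k * (Λ / a ^ k))
      have h4 := arctan_lt_pi_div_two (k * (Λ / b ^ k))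
      simp only [Pi.add_apply]
      nlinarith

/-- For every real `k > 0` there is a constant `C = C(k)` such that for all real `x`, `Λ`
and all `0 < a ≤ b`, the integral of `sin (x·η + Λ/η^k)/η` over `[a, b]` is bounded by `C`. -/
theorem abs_integral_sin_phase_div_le (k : ℝ) (hk : 0 < k) :
    ∃ C : ℝ, ∀ x Λ a b : ℝ, 0 < a → a ≤ b →
      |∫ η in a..b, Real.sin (x * η + Λ / η ^ k) / η| ≤ C := by
  refine ⟨1 + (2 + (1 + k ^ 2) / k ^ 2) * π, fun x Λ a b ha hab => ?_⟩
  rcases le_total 0 x with hx | hx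
  · exact abs_integral_sin_phase_div_le_of_nonneg hk hx Λ ha hab
  · have h := abs_integral_sin_phase_div_le_of_nonneg hk (neg_nonneg.2 hx) (-Λ) ha hab
    have hodd : ∀ η : ℝ, sin (-x * η + -Λ / η ^ k) / η = -(sin (x * η + Λ / η ^ k) / η) :=
      fun η => by
        rw [show -x * η + -Λ / η ^ k = -(x * η + Λ / η ^ k) by ring, sin_neg, neg_div]
    simpa only [hodd, integral_neg, abs_neg] using h
end

section
/- For all real numbers a, b with 0 ≤ a ≤ b, one has |∫_a^b (sin v)/v dv| ≤ 3·∫_0^π (sin v)/v dv. -/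
open intervalIntegral Real

theorem sin_div_self_ae_eq_sinc :
    (fun v : ℝ => Real.sin v / v) =ᵐ[MeasureTheory.volume] Real.sinc := by
  filter_upwards [MeasureTheory.Measure.ae_ne MeasureTheory.volume (0 : ℝ)] with v hv
  exact (Real.sinc_of_ne_zero hv).symm

theorem integral_sin_div_self_eq_integral_sinc (a b : ℝ) :
    ∫ v in a..b, Real.sin v / v = ∫ v in a..b, Real.sinc v :=
  intervalIntegral.integral_congr_ae (sin_div_self_ae_eq_sinc.mono fun _ h _ => h)

theorem intervalIntegrable_sinc (a b : ℝ) :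
    IntervalIntegrable Real.sinc MeasureTheory.volume a b :=
  Real.continuous_sinc.intervalIntegrable a b

theorem abs_integral_sinc_le_two_div {a b : ℝ} (ha : 0 < a) (hab : a ≤ b) :
    |∫ v in a..b, Real.sinc v| ≤ 2 / a := by
  have hb : 0 < b := ha.trans_le hab
  have hderiv (c : ℝ) : ∀ v : ℝ, 0 < v → HasDerivAt (fun v => (c - Real.cos v) / v)
      ((Real.sin v * v - (c - Real.cos v)) / v ^ 2) v := fun v hv => by
    simpa using ((Real.hasDerivAt_cos v).const_sub c).fun_div (hasDerivAt_id' v) hv.ne'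
  have hcont (c : ℝ) : ContinuousOn (fun v => (c - Real.cos v) / v) (Set.Icc a b) :=
    fun v hv => (hderiv c v (ha.trans_le hv.1)).continuousAt.continuousWithinAt
  have hint : MeasureTheory.IntegrableOn Real.sinc (Set.Icc a b) :=
    Real.continuous_sinc.integrableOn_Icc
  have hupper : ∫ v in a..b, Real.sinc v ≤ (-1 - Real.cos b) / b - (-1 - Real.cos a) / a := by
    refine integral_le_sub_of_hasDeriv_right_of_le hab (hcont (-1))
      (fun v hv => (hderiv (-1) v (ha.trans hv.1)).hasDerivWithinAt) hint fun v hv => ?_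
    have hv0 : 0 < v := ha.trans hv.1
    rw [Real.sinc_of_ne_zero hv0.ne', div_le_div_iff₀ hv0 (by positivity)]
    nlinarith [mul_nonneg hv0.le (by linarith [Real.neg_one_le_cos v] : 0 ≤ 1 + Real.cos v)]
  have hlower : (1 - Real.cos b) / b - (1 - Real.cos a) / a ≤ ∫ v in a..b, Real.sinc v := by
    refine sub_le_integral_of_hasDeriv_right_of_le hab (hcont 1)
      (fun v hv => (hderiv 1 v (ha.trans hv.1)).hasDerivWithinAt) hint fun v hv => ?_
    have hv0 : 0 < v := ha.trans hv.1
    rw [Real.sinc_of_ne_zero hv0.ne', div_le_div_iff₀ (by positivity) hv0]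
    nlinarith [mul_nonneg hv0.le (by linarith [Real.cos_le_one v] : 0 ≤ 1 - Real.cos v)]
  have h₁ : (-1 - Real.cos b) / b ≤ 0 :=
    div_nonpos_of_nonpos_of_nonneg (by linarith [Real.neg_one_le_cos b]) hb.le
  have h₂ : 0 ≤ (1 - Real.cos b) / b :=
    div_nonneg (by linarith [Real.cos_le_one b]) hb.le
  have h₃ : -(2 / a) ≤ (-1 - Real.cos a) / a := by
    rw [← neg_div]
    gcongr
    linarith [Real.cos_le_one a]
  have h₄ : (1 - Real.cos a) / a ≤ 2 / a := by
    gcongr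
    linarith [Real.neg_one_le_cos a]
  exact abs_le.2 ⟨by linarith, by linarith⟩

theorem one_le_integral_sinc_zero_pi : 1 ≤ ∫ v in (0 : ℝ)..Real.pi, Real.sinc v := by
  have hpi := Real.pi_pos
  have hleft : ∫ _v in (0 : ℝ)..(Real.pi / 2), 2 / Real.pi ≤
      ∫ v in (0 : ℝ)..(Real.pi / 2), Real.sinc v := by
    refine integral_mono_on_of_le_Ioo (by positivity) (by simp) (intervalIntegrable_sinc _ _)
      fun v hv => ?_
    rw [Real.sinc_of_ne_zero hv.1.ne', le_div_iff₀ hv.1]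
    exact Real.mul_le_sin hv.1.le hv.2.le
  have hright : 0 ≤ ∫ v in (Real.pi / 2)..Real.pi, Real.sinc v := by
    refine integral_nonneg (by linarith) fun v hv => ?_
    have hv0 : 0 < v := by linarith [hv.1]
    rw [Real.sinc_of_ne_zero hv0.ne']
    exact div_nonneg (Real.sin_nonneg_of_nonneg_of_le_pi hv0.le hv.2) hv0.le
  have hconst : ∫ _v in (0 : ℝ)..(Real.pi / 2), 2 / Real.pi = 1 := by
    rw [intervalIntegral.integral_const, smul_eq_mul]
    field_simp
    ring
  rw [← integral_add_adjacent_intervals (intervalIntegrable_sinc 0 (Real.pi / 2))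
    (intervalIntegrable_sinc (Real.pi / 2) Real.pi)]
  linarith

theorem abs_integral_sinc_le_sub {a b : ℝ} (hab : a ≤ b) :
    |∫ v in a..b, Real.sinc v| ≤ b - a := by
  have h := norm_integral_le_of_norm_le_const (a := a) (b := b) (f := Real.sinc) (C := 1)
    fun v _ => Real.abs_sinc_le_one v
  rwa [one_mul, Real.norm_eq_abs, abs_of_nonneg (sub_nonneg.2 hab)] at h

theorem abs_integral_sinc_le_three {a b : ℝ} (ha : 0 ≤ a) (hab : a ≤ b) :
    |∫ v in a..b, Real.sinc v| ≤ 3 := by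
  rcases le_total 1 a with h1a | ha1
  · have h2 : 2 / a ≤ 2 := div_le_self zero_le_two h1a
    linarith [abs_integral_sinc_le_two_div (zero_lt_one.trans_le h1a) hab]
  rcases le_total b 1 with hb1 | h1b
  · linarith [abs_integral_sinc_le_sub hab]
  · rw [← integral_add_adjacent_intervals (intervalIntegrable_sinc a 1)
      (intervalIntegrable_sinc 1 b)]
    linarith [abs_add_le (∫ v in a..1, Real.sinc v) (∫ v in 1..b, Real.sinc v),
      abs_integral_sinc_le_sub ha1, abs_integral_sinc_le_two_div zero_lt_one h1b]

/-- For all `0 ≤ a ≤ b`, the integral of `sin v / v` over `[a, b]` is at most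
`3` times its integral over `[0, π]`. -/
theorem abs_integral_sinc_le (a b : ℝ) (ha : 0 ≤ a) (hab : a ≤ b) :
    |∫ v in a..b, Real.sin v / v| ≤ 3 * ∫ v in (0:ℝ)..Real.pi, Real.sin v / v := by
  rw [integral_sin_div_self_eq_integral_sinc, integral_sin_div_self_eq_integral_sinc]
  linarith [abs_integral_sinc_le_three ha hab, one_le_integral_sinc_zero_pi]
end

section
/- For every real k > 0, every Λ > 0, every real x, and all real numbers a, b with Λ^{1/k} ≤ a ≤ b, one has |∫_a^b [sin(x·ξ + Λ/ξ^k) − sin(x·ξ)] / ξ dξ| ≤ 1/k. -/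
open intervalIntegral Real

/-- For `k > 0`, `Λ > 0`, any real `x`, and `Λ^(1/k) ≤ a ≤ b`, the integral over `[a,b]` of
`(sin (x·ξ + Λ/ξ^k) − sin (x·ξ))/ξ` is bounded in absolute value by `1/k`. -/
theorem abs_integral_sin_difference_le (k : ℝ) (hk : 0 < k) (Λ : ℝ) (hΛ : 0 < Λ)
    (x a b : ℝ) (ha : Λ ^ (1 / k) ≤ a) (hab : a ≤ b) :
    |∫ ξ in a..b, (Real.sin (x * ξ + Λ / ξ ^ k) - Real.sin (x * ξ)) / ξ| ≤ 1 / k := by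
  have ha0 : 0 < a := (rpow_pos_of_pos hΛ _).trans_le ha
  have hΛa : Λ ≤ a ^ k := by
    rwa [one_div, rpow_inv_le_iff_of_pos hΛ.le ha0.le hk] at ha
  have h0 : (0 : ℝ) ∉ Set.uIcc a b := by
    rw [Set.uIcc_of_le hab]
    exact fun h => absurd h.1 ha0.not_ge
  have hbound : ∀ ξ ∈ Set.Ioc a b,
      ‖(Real.sin (x * ξ + Λ / ξ ^ k) - Real.sin (x * ξ)) / ξ‖ ≤ Λ * ξ ^ (-k - 1) := by
    intro ξ hξ
    have hξ0 : 0 < ξ := ha0.trans hξ.1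
    have hsin := abs_sin_sub_sin_le (x * ξ + Λ / ξ ^ k) (x * ξ)
    rw [add_sub_cancel_left, abs_of_pos (div_pos hΛ (rpow_pos_of_pos hξ0 k))] at hsin
    rw [norm_eq_abs, abs_div, abs_of_pos hξ0, rpow_sub_one hξ0.ne', rpow_neg hξ0.le,
      ← mul_div_assoc, ← div_eq_mul_inv]
    gcongr
  calc _ ≤ ∫ ξ in a..b, Λ * ξ ^ (-k - 1) :=
        norm_integral_le_of_norm_le hab (.of_forall hbound)
          ((intervalIntegrable_rpow (.inr h0)).const_mul Λ)
    _ = (Λ * a ^ (-k) - Λ * b ^ (-k)) / k := by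
        rw [intervalIntegral.integral_const_mul,
          integral_rpow (.inr ⟨by linarith, h0⟩), sub_add_cancel]
        field_simp
        ring
    _ ≤ 1 / k := by
        gcongr
        have hb : 0 ≤ Λ * b ^ (-k) := mul_nonneg hΛ.le (rpow_nonneg (ha0.le.trans hab) _)
        have ha1 : Λ * a ^ (-k) ≤ 1 := by
          rw [rpow_neg ha0.le, ← div_eq_mul_inv]
          exact div_le_one_of_le₀ hΛa (rpow_nonneg ha0.le k)
        linarith
end

section
/- There is an absolute constant C such that the following holds: for every continuously differentiable function g : ℝ → ℝ with g(ξ) = 0 for all ξ ≤ 1, with sup_{ξ∈ℝ} |g(ξ)| < ∞ and ∫_0^∞ |g'(ξ)| dξ < ∞, and for all real numbers x and Λ and every M > 0, one has |∫_0^M g(ξ) · sin(x·ξ + Λ/ξ) / ξ dξ| ≤ C · ( sup_{ξ∈ℝ} |g(ξ)| + ∫_0^∞ |g'(ξ)| dξ ). -/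
open intervalIntegral Real MeasureTheory

open Set

/-- The kernel `η ↦ sin (xη + Λ/η) / η`. -/
noncomputable def sinPhaseKernel (x Λ η : ℝ) : ℝ := Real.sin (x * η + Λ / η) / η

lemma continuousAt_sinPhaseKernel (x Λ : ℝ) {η : ℝ} (hη : 0 < η) :
    ContinuousAt (sinPhaseKernel x Λ) η := by
  unfold sinPhaseKernel
  have := hη.ne'
  fun_prop (disch := assumption)

lemma intervalIntegrable_sinPhaseKernel (x Λ : ℝ) {a b : ℝ} (ha : 0 < a) (hab : a ≤ b) :
    IntervalIntegrable (sinPhaseKernel x Λ) volume a b := by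
  refine ContinuousOn.intervalIntegrable fun η hη => ?_
  rw [uIcc_of_le hab] at hη
  exact (continuousAt_sinPhaseKernel x Λ (ha.trans_le hη.1)).continuousWithinAt

lemma hasDerivAt_integral_sinPhaseKernel (x Λ : ℝ) {y : ℝ} (hy : 1 ≤ y) :
    HasDerivAt (fun z => ∫ η in (1 : ℝ)..z, sinPhaseKernel x Λ η) (sinPhaseKernel x Λ y) y := by
  have hm : Measurable (sinPhaseKernel x Λ) := by
    unfold sinPhaseKernel
    fun_prop
  exact integral_hasDerivAt_right (intervalIntegrable_sinPhaseKernel x Λ one_pos hy)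
    hm.stronglyMeasurable.stronglyMeasurableAtFilter
    (continuousAt_sinPhaseKernel x Λ (one_pos.trans_le hy))

/-- Bounds for an integral over intervals on either side of `c` combine to a bound over every
interval. -/
lemma abs_integral_sinPhaseKernel_le_add {x Λ a b c K₁ K₂ : ℝ} (ha : 0 < a) (hab : a ≤ b)
    (hK₁ : 0 ≤ K₁) (hK₂ : 0 ≤ K₂)
    (h₁ : ∀ v, a ≤ v → v ≤ b → v ≤ c → |∫ η in a..v, sinPhaseKernel x Λ η| ≤ K₁)
    (h₂ : ∀ u, a ≤ u → u ≤ b → c ≤ u → |∫ η in u..b, sinPhaseKernel x Λ η| ≤ K₂) :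
    |∫ η in a..b, sinPhaseKernel x Λ η| ≤ K₁ + K₂ := by
  rcases le_total b c with hbc | hcb
  · linarith [h₁ b hab le_rfl hbc]
  rcases le_total c a with hca | hac
  · linarith [h₂ a le_rfl hab hca]
  rw [← integral_add_adjacent_intervals (intervalIntegrable_sinPhaseKernel x Λ ha hac)
    (intervalIntegrable_sinPhaseKernel x Λ (ha.trans_le hac) hcb)]
  exact (abs_add_le _ _).trans (add_le_add (h₁ c hac hcb le_rfl) (h₂ c hac hcb le_rfl))

lemma integral_sinPhaseKernel_swap (x Λ : ℝ) {a b : ℝ} (ha : 0 < a) (hab : a ≤ b) :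
    ∫ η in b⁻¹..a⁻¹, sinPhaseKernel Λ x η = ∫ η in a..b, sinPhaseKernel x Λ η := by
  have hpos : ∀ η ∈ uIcc a b, 0 < η := fun η hη => by
    rw [uIcc_of_le hab] at hη
    exact ha.trans_le hη.1
  have h := integral_comp_mul_deriv' (a := a) (b := b) (f := fun η : ℝ => η⁻¹)
    (f' := fun η => -(η ^ 2)⁻¹) (g := sinPhaseKernel Λ x)
    (fun η hη => hasDerivAt_inv (hpos η hη).ne')
    (fun η hη => by
      have := (hpos η hη).ne'
      have h2 : η ^ 2 ≠ 0 := pow_ne_zero 2 this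
      apply ContinuousAt.continuousWithinAt
      fun_prop (disch := assumption))
    (by
      rintro _ ⟨η, hη, rfl⟩
      exact (continuousAt_sinPhaseKernel Λ x (inv_pos.2 (hpos η hη))).continuousWithinAt)
  rw [integral_symm, ← h, ← intervalIntegral.integral_neg]
  refine integral_congr fun η hη => ?_
  have := (hpos η hη).ne'
  simp only [sinPhaseKernel, Function.comp]
  have e : Λ * η⁻¹ + x / η⁻¹ = x * η + Λ / η := by
    field_simp
    ring
  rw [e]
  field_simp

/-- Non-oscillatory regime. -/
lemma abs_integral_sinPhaseKernel_le_two {x Λ a b : ℝ} (ha : 0 < a) (hab : a ≤ b)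
    (hΛ : 2 * |Λ| ≤ |x| * a ^ 2) (hb : |x| * b ≤ 1) :
    |∫ η in a..b, sinPhaseKernel x Λ η| ≤ 2 := by
  have h : ‖∫ η in a..b, sinPhaseKernel x Λ η‖ ≤ (2 * |x|) * |b - a| := by
    refine norm_integral_le_of_norm_le_const fun η hη => ?_
    rw [uIoc_of_le hab] at hη
    have hη0 : 0 < η := ha.trans hη.1
    have hΛη : |Λ| ≤ |x| * η ^ 2 := by
      have : |x| * a ^ 2 ≤ |x| * η ^ 2 := by
        have := hη.1.le
        gcongr
      linarith [abs_nonneg Λ]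
    rw [Real.norm_eq_abs, sinPhaseKernel, abs_div, abs_of_pos hη0, div_le_iff₀ hη0]
    calc |Real.sin (x * η + Λ / η)| ≤ |x * η + Λ / η| := abs_sin_le_abs
      _ ≤ |x * η| + |Λ / η| := abs_add_le _ _
      _ = |x| * η + |Λ| / η := by rw [abs_mul, abs_div, abs_of_pos hη0]
      _ ≤ |x| * η + |x| * η := by
        gcongr
        rw [div_le_iff₀ hη0]
        linarith
      _ = 2 * |x| * η := by ring
  rw [Real.norm_eq_abs, abs_of_nonneg (sub_nonneg.2 hab)] at h
  nlinarith [abs_nonneg x, mul_nonneg (abs_nonneg x) ha.le]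

/-- Oscillatory regime, by integration by parts. -/
lemma abs_integral_sinPhaseKernel_le_ten {x Λ a b : ℝ} (ha : 0 < a) (hab : a ≤ b)
    (hΛ : 2 * |Λ| ≤ |x| * a ^ 2) (hxa : 1 ≤ |x| * a) :
    |∫ η in a..b, sinPhaseKernel x Λ η| ≤ 10 := by
  have hx : 0 < |x| := by
    by_contra h
    have : |x| = 0 := le_antisymm (not_lt.1 h) (abs_nonneg x)
    rw [this] at hxa
    linarith
  have hΛη : ∀ η, a ≤ η → 2 * |Λ| ≤ |x| * η ^ 2 := fun η hη => hΛ.trans (by gcongr)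
  have hψ : ∀ η, a ≤ η → |x| * η / 2 ≤ |x * η - Λ / η| := fun η hη => by
    have hη0 := ha.trans_le hη
    have h1 : |x * η| - |Λ / η| ≤ |x * η - Λ / η| := abs_sub_abs_le_abs_sub _ _
    rw [abs_mul, abs_div, abs_of_pos hη0] at h1
    have h2 : |Λ| / η ≤ |x| * η / 2 := by
      rw [div_le_iff₀ hη0]
      linarith [hΛη η hη]
    linarith
  have hψ0 : ∀ η, a ≤ η → x * η - Λ / η ≠ 0 := fun η hη h => by
    have := hψ η hη
    rw [h, abs_zero] at this
    have := mul_pos hx (ha.trans_le hη)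
    linarith
  set G : ℝ → ℝ := fun η => -Real.cos (x * η + Λ / η) / (x * η - Λ / η) with hG
  set r : ℝ → ℝ := fun η => Real.cos (x * η + Λ / η) * (x + Λ / η ^ 2) / (x * η - Λ / η) ^ 2
    with hr
  have hderiv : ∀ η ∈ uIcc a b, HasDerivAt G (sinPhaseKernel x Λ η + r η) η := fun η hη => by
    rw [uIcc_of_le hab] at hη
    have hη0 := ha.trans_le hη.1
    have h0 := hψ0 η hη.1
    have hd : HasDerivAt (fun η : ℝ => Λ / η) (-Λ / η ^ 2) η := by
      simpa [div_eq_mul_inv] using (hasDerivAt_inv hη0.ne').const_mul Λ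
    have hl : HasDerivAt (fun η : ℝ => x * η) x η := by
      simpa using (hasDerivAt_id η).const_mul x
    refine (((hl.add hd).cos.neg).div (hl.sub hd) h0).congr_deriv ?_
    simp only [sinPhaseKernel, hr, Pi.add_apply, Pi.sub_apply, Pi.neg_apply]
    have h1 : x * η ^ 2 - Λ ≠ 0 := fun h => h0 (by
      field_simp
      linarith)
    generalize Real.sin (x * η + Λ / η) = S
    generalize Real.cos (x * η + Λ / η) = T
    have e : x * η - Λ / η = (x * η ^ 2 - Λ) / η := by field_simp
    rw [e]
    field_simp
    ring
  have hrc : ContinuousOn r (uIcc a b) := fun η hη => by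
    rw [uIcc_of_le hab] at hη
    have hη0 := (ha.trans_le hη.1).ne'
    have h2 : η ^ 2 ≠ 0 := pow_ne_zero 2 hη0
    have h3 : (x * η - Λ / η) ^ 2 ≠ 0 := pow_ne_zero 2 (hψ0 η hη.1)
    apply ContinuousAt.continuousWithinAt
    rw [hr]
    fun_prop (disch := assumption)
  have hri := hrc.intervalIntegrable (μ := volume)
  have hsi := intervalIntegrable_sinPhaseKernel x Λ ha hab
  have key := integral_eq_sub_of_hasDerivAt hderiv (hsi.add hri)
  rw [intervalIntegral.integral_add hsi hri] at key
  have hGb : ∀ η, a ≤ η → |G η| ≤ 2 := fun η hη => by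
    have h1 := hψ η hη
    have h2 : |x| * a ≤ |x| * η := by gcongr
    rw [hG]
    simp only
    rw [abs_div, abs_neg, div_le_iff₀ (abs_pos.2 (hψ0 η hη))]
    linarith [abs_cos_le_one (x * η + Λ / η)]
  have hq : ∀ η ∈ uIcc a b, HasDerivAt (fun η : ℝ => -(6 / |x|) * η⁻¹) (6 / (|x| * η ^ 2)) η := by
    intro η hη
    rw [uIcc_of_le hab] at hη
    have hη0 := (ha.trans_le hη.1).ne'
    refine ((hasDerivAt_inv hη0).const_mul (-(6 / |x|))).congr_deriv ?_
    field_simp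
  have hqi : IntervalIntegrable (fun η : ℝ => 6 / (|x| * η ^ 2)) volume a b := by
    refine ContinuousOn.intervalIntegrable fun η hη => ?_
    rw [uIcc_of_le hab] at hη
    have h2 : |x| * η ^ 2 ≠ 0 := (mul_pos hx (pow_pos (ha.trans_le hη.1) 2)).ne'
    apply ContinuousAt.continuousWithinAt
    fun_prop (disch := assumption)
  have hrb : |∫ η in a..b, r η| ≤ 6 := by
    have h1 : ‖∫ η in a..b, r η‖ ≤ ∫ η in a..b, 6 / (|x| * η ^ 2) := by
      refine norm_integral_le_of_norm_le hab (Filter.Eventually.of_forall fun η hη => ?_) hqi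
      have hη0 : 0 < η := ha.trans hη.1
      have h2 := hψ η hη.1.le
      have h3 : |x + Λ / η ^ 2| ≤ 3 / 2 * |x| := by
        refine (abs_add_le _ _).trans ?_
        rw [abs_div, abs_of_pos (pow_pos hη0 2)]
        have : |Λ| / η ^ 2 ≤ |x| / 2 := by
          rw [div_le_iff₀ (pow_pos hη0 2)]
          linarith [hΛη η hη.1.le]
        linarith
      rw [Real.norm_eq_abs, hr]
      simp only
      rw [abs_div, abs_mul, abs_pow]
      calc _ ≤ 1 * (3 / 2 * |x|) / (|x| * η / 2) ^ 2 := by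
            gcongr
            exact abs_cos_le_one _
        _ = 6 / (|x| * η ^ 2) := by
            field_simp
            norm_num
    rw [integral_eq_sub_of_hasDerivAt hq hqi, Real.norm_eq_abs] at h1
    have h4 : 6 / |x| * b⁻¹ ≥ 0 := by
      have := ha.trans_le hab
      positivity
    have h5 : 6 / |x| * a⁻¹ ≤ 6 := by
      rw [← div_eq_mul_inv, div_div, div_le_iff₀ (by positivity)]
      linarith
    linarith
  have e : ∫ η in a..b, sinPhaseKernel x Λ η = G b - G a - ∫ η in a..b, r η := by linarith
  rw [e]
  have h1 := abs_le.1 (hGb a le_rfl)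
  have h2 := abs_le.1 (hGb b hab)
  have h3 := abs_le.1 hrb
  rw [abs_le]
  constructor <;> linarith [h1.1, h1.2, h2.1, h2.2, h3.1, h3.2]

/-- Regime where the term `x η` of the phase dominates. -/
lemma abs_integral_sinPhaseKernel_le_of_dominant {x Λ a b : ℝ} (ha : 0 < a) (hab : a ≤ b)
    (hΛ : 2 * |Λ| ≤ |x| * a ^ 2) :
    |∫ η in a..b, sinPhaseKernel x Λ η| ≤ 12 := by
  rcases (abs_nonneg x).eq_or_lt with hx | hx
  · have := abs_integral_sinPhaseKernel_le_two ha hab hΛ (by simp [← hx])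
    linarith
  have h := abs_integral_sinPhaseKernel_le_add (x := x) (Λ := Λ) (c := 1 / |x|) (K₁ := 2)
    (K₂ := 10) ha hab (by norm_num) (by norm_num)
    (fun v hv _ hvc => abs_integral_sinPhaseKernel_le_two ha hv hΛ (by
      rw [le_div_iff₀ hx] at hvc
      linarith))
    (fun u hu hub hcu => abs_integral_sinPhaseKernel_le_ten (ha.trans_le hu) hub
      (hΛ.trans (by gcongr)) (by
        rw [div_le_iff₀ hx] at hcu
        linarith))
  linarith

/-- Regime where the term `Λ / η` of the phase dominates. -/
lemma abs_integral_sinPhaseKernel_le_of_dominant' {x Λ a b : ℝ} (ha : 0 < a) (hab : a ≤ b)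
    (hx : 2 * (|x| * b ^ 2) ≤ |Λ|) :
    |∫ η in a..b, sinPhaseKernel x Λ η| ≤ 12 := by
  have hb := ha.trans_le hab
  rw [← integral_sinPhaseKernel_swap x Λ ha hab]
  refine abs_integral_sinPhaseKernel_le_of_dominant (inv_pos.2 hb) (inv_anti₀ ha hab) ?_
  rw [inv_pow, ← div_eq_mul_inv, le_div_iff₀ (pow_pos hb 2)]
  linarith

/-- Near the stationary point of the phase the interval has bounded logarithmic length. -/
lemma abs_integral_sinPhaseKernel_le_one {x Λ a b : ℝ} (ha : 0 < a) (hab : a ≤ b)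
    (hb : b ≤ 2 * a) : |∫ η in a..b, sinPhaseKernel x Λ η| ≤ 1 := by
  have h : ‖∫ η in a..b, sinPhaseKernel x Λ η‖ ≤ a⁻¹ * |b - a| := by
    refine norm_integral_le_of_norm_le_const fun η hη => ?_
    rw [uIoc_of_le hab] at hη
    have hη0 : 0 < η := ha.trans hη.1
    rw [Real.norm_eq_abs, sinPhaseKernel, abs_div, abs_of_pos hη0, inv_eq_one_div]
    have := hη.1.le
    gcongr
    exact abs_sin_le_one _
  rw [Real.norm_eq_abs, abs_of_nonneg (sub_nonneg.2 hab)] at h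
  refine h.trans ?_
  rw [inv_mul_le_iff₀ ha]
  linarith

/-- The integrals of `sin (xη + Λ/η) / η` over intervals in `(0, ∞)` are uniformly bounded. -/
lemma abs_integral_sinPhaseKernel_le (x Λ : ℝ) {a b : ℝ} (ha : 0 < a) (hab : a ≤ b) :
    |∫ η in a..b, sinPhaseKernel x Λ η| ≤ 25 := by
  rcases (abs_nonneg x).eq_or_lt with hx | hx
  · have := abs_integral_sinPhaseKernel_le_of_dominant' (x := x) (Λ := Λ) ha hab
      (by simp [← hx])
    linarith
  set c := √(|Λ| / (2 * |x|)) with hc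
  have hc0 : 0 ≤ c := Real.sqrt_nonneg _
  have hc2 : 2 * (|x| * c ^ 2) = |Λ| := by
    rw [hc, Real.sq_sqrt (by positivity)]
    field_simp
  have h := abs_integral_sinPhaseKernel_le_add (x := x) (Λ := Λ) (c := c) (K₁ := 12)
    (K₂ := 1 + 12) ha hab (by norm_num) (by norm_num)
    (fun v hv _ hvc => abs_integral_sinPhaseKernel_le_of_dominant' ha hv (by
      have := ha.trans_le hv
      rw [← hc2]
      gcongr))
    (fun u hu hub hcu => abs_integral_sinPhaseKernel_le_add (c := 2 * c) (ha.trans_le hu) hub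
      (by norm_num) (by norm_num)
      (fun v hv _ hvc => abs_integral_sinPhaseKernel_le_one (ha.trans_le hu) hv (by linarith))
      (fun w hw hwb hcw => abs_integral_sinPhaseKernel_le_of_dominant
        ((ha.trans_le hu).trans_le hw) hwb (by
          have : |x| * (2 * c) ^ 2 ≤ |x| * w ^ 2 := by gcongr
          linarith)))
  linarith

/-- There is an absolute constant `C` such that for every `C¹` function `g : ℝ → ℝ` vanishing
on `(-∞, 1]`, bounded, and with `∫_0^∞ |g'| < ∞`, and for all real `x`, `Λ` and `M > 0`,
`|∫_0^M g(ξ) sin(xξ + Λ/ξ)/ξ dξ| ≤ C (sup |g| + ∫_0^∞ |g'|)`. -/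
theorem abs_integral_cutoff_sin_phase_le :
    ∃ C : ℝ, ∀ g : ℝ → ℝ, ContDiff ℝ 1 g → (∀ ξ : ℝ, ξ ≤ 1 → g ξ = 0) →
      BddAbove (Set.range fun ξ => |g ξ|) →
      IntegrableOn (fun ξ => |deriv g ξ|) (Set.Ioi 0) →
      ∀ x Λ M : ℝ, 0 < M →
        |∫ ξ in (0:ℝ)..M, g ξ * Real.sin (x * ξ + Λ / ξ) / ξ| ≤
          C * ((⨆ ξ : ℝ, |g ξ|) + ∫ ξ in Set.Ioi (0:ℝ), |deriv g ξ|) := by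
  refine ⟨25, fun g hg hg1 hbd hint x Λ M _ => ?_⟩
  have hI : 0 ≤ ∫ ξ in Set.Ioi (0 : ℝ), |deriv g ξ| := integral_nonneg fun _ => abs_nonneg _
  have hsup : ∀ ξ, |g ξ| ≤ ⨆ ξ : ℝ, |g ξ| := fun ξ => le_ciSup hbd ξ
  have hS : 0 ≤ ⨆ ξ : ℝ, |g ξ| := (abs_nonneg _).trans (hsup 0)
  have hzero : ∀ m : ℝ, 0 ≤ m → m ≤ 1 →
      EqOn (fun ξ => g ξ * Real.sin (x * ξ + Λ / ξ) / ξ) 0 (uIcc 0 m) := fun m hm0 hm ξ hξ => by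
    rw [uIcc_of_le hm0] at hξ
    simp [hg1 ξ (hξ.2.trans hm)]
  rcases le_total M 1 with hM | hM
  · rw [integral_congr (hzero M (by linarith) hM)]
    simp only [Pi.zero_apply, intervalIntegral.integral_zero, abs_zero]
    positivity
  set F : ℝ → ℝ := fun z => ∫ η in (1 : ℝ)..z, sinPhaseKernel x Λ η with hF
  have hFb : ∀ z, 1 ≤ z → |F z| ≤ 25 := fun z hz => abs_integral_sinPhaseKernel_le x Λ one_pos hz
  have hg' : Continuous (deriv g) := hg.continuous_deriv le_rfl
  have hsi := intervalIntegrable_sinPhaseKernel x Λ one_pos hM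
  have hparts := integral_mul_deriv_eq_deriv_mul (a := 1) (b := M) (u := g) (v := F)
    (fun ξ _ => (hg.differentiable one_ne_zero ξ).hasDerivAt)
    (fun ξ hξ => by
      rw [uIcc_of_le hM] at hξ
      exact hasDerivAt_integral_sinPhaseKernel x Λ hξ.1)
    (hg'.intervalIntegrable 1 M) hsi
  have hfun : (fun ξ => g ξ * Real.sin (x * ξ + Λ / ξ) / ξ) =
      fun ξ => g ξ * sinPhaseKernel x Λ ξ := by
    funext ξ
    rw [sinPhaseKernel, mul_div_assoc]
  have h01 : IntervalIntegrable (fun ξ => g ξ * Real.sin (x * ξ + Λ / ξ) / ξ) volume 0 1 :=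
    (continuousOn_const.congr (hzero 1 zero_le_one le_rfl)).intervalIntegrable
  have h1M : IntervalIntegrable (fun ξ => g ξ * Real.sin (x * ξ + Λ / ξ) / ξ) volume 1 M := by
    rw [hfun]
    exact hsi.continuousOn_mul hg.continuous.continuousOn
  rw [← integral_add_adjacent_intervals h01 h1M, integral_congr (hzero 1 zero_le_one le_rfl),
    hfun]
  simp only [Pi.zero_apply, intervalIntegral.integral_zero, zero_add]
  rw [hparts, hg1 1 le_rfl, zero_mul, sub_zero]
  have hrem : ‖∫ ξ in (1 : ℝ)..M, deriv g ξ * F ξ‖ ≤ ∫ ξ in (1 : ℝ)..M, 25 * |deriv g ξ| := by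
    refine norm_integral_le_of_norm_le hM (Filter.Eventually.of_forall fun ξ hξ => ?_)
      ((continuous_const.mul hg'.abs).intervalIntegrable 1 M)
    rw [Real.norm_eq_abs, abs_mul, mul_comm]
    exact mul_le_mul_of_nonneg_right (hFb ξ hξ.1.le) (abs_nonneg _)
  have hmono : ∫ ξ in (1 : ℝ)..M, |deriv g ξ| ≤ ∫ ξ in Set.Ioi (0 : ℝ), |deriv g ξ| := by
    rw [integral_of_le hM]
    exact setIntegral_mono_set hint (Filter.Eventually.of_forall fun _ => abs_nonneg _)
      (Filter.Eventually.of_forall fun ξ hξ => one_pos.trans hξ.1)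
  rw [intervalIntegral.integral_const_mul, Real.norm_eq_abs] at hrem
  have hbdry : |g M * F M| ≤ (⨆ ξ : ℝ, |g ξ|) * 25 := by
    rw [abs_mul]
    exact mul_le_mul (hsup M) (hFb M hM) (abs_nonneg _) hS
  have := abs_sub (g M * F M) (∫ ξ in (1 : ℝ)..M, deriv g ξ * F ξ)
  linarith
end

section
/- Let d ≥ 2 and let h : ℝ^d \ {0} → ℂ be continuously differentiable and positively homogeneous of degree −1 (that is, h(sξ) = s^{-1} h(ξ) for all s > 0 and ξ ≠ 0). Write ξ = (ξ₁, ξ') ∈ ℝ × ℝ^{d-1} and assume h(ξ₁, 0) = 0 for all ξ₁ > 0. Then there is a constant C such that: (i) |h(ξ₁, ξ')| ≤ C·|ξ'| / (ξ₁² + |ξ'|²) for all ξ₁ ≥ 2 and all ξ' ∈ ℝ^{d-1}; and (ii) ∫_2^∞ |h(ξ₁, ξ')| dξ₁ ≤ C·|ξ'| for all ξ' ∈ ℝ^{d-1}. -/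
open MeasureTheory

/-- A `C¹` map vanishing at the origin is dominated by a multiple of the norm on the unit ball. -/
lemma ContDiff.exists_norm_le_mul_norm_of_map_zero {E F : Type*} [NormedAddCommGroup E]
    [NormedSpace ℝ E] [ProperSpace E] [NormedAddCommGroup F] [NormedSpace ℝ F] {g : E → F}
    (hg : ContDiff ℝ 1 g) (hg0 : g 0 = 0) :
    ∃ L : ℝ, ∀ y : E, ‖y‖ ≤ 1 → ‖g y‖ ≤ L * ‖y‖ := by
  obtain ⟨L, hL⟩ := (isCompact_closedBall (0 : E) 1).exists_bound_of_continuousOn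
    (hg.continuous_fderiv one_ne_zero).continuousOn
  refine ⟨L, fun y hy => ?_⟩
  have := (convex_closedBall (0 : E) 1).norm_image_sub_le_of_norm_fderiv_le (𝕜 := ℝ)
    (fun x _ => hg.differentiable one_ne_zero x) hL
    (Metric.mem_closedBall_self zero_le_one) (mem_closedBall_zero_iff.2 hy)
  simpa [hg0] using this

/-- A function that is `C¹` and homogeneous of degree `-1` away from the origin and vanishes on
the positive first axis is `O(‖y‖ / (t ^ 2 + ‖y‖ ^ 2))` on the half space `t > 0`. -/
lemma exists_norm_le_mul_div_of_homogeneous {E : Type*} [NormedAddCommGroup E]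
    [NormedSpace ℝ E] [ProperSpace E] {h : ℝ × E → ℂ}
    (hsmooth : ContDiffOn ℝ 1 h {ξ : ℝ × E | ξ ≠ 0})
    (hhom : ∀ s : ℝ, 0 < s → ∀ ξ : ℝ × E, ξ ≠ 0 → h (s • ξ) = (s : ℂ)⁻¹ * h ξ)
    (hvanish : ∀ t : ℝ, 0 < t → h (t, 0) = 0) :
    ∃ C : ℝ, 0 ≤ C ∧ ∀ t : ℝ, 0 < t → ∀ y : E,
      ‖h (t, y)‖ ≤ C * ‖y‖ / (t ^ 2 + ‖y‖ ^ 2) := by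
  have hsection : ContDiff ℝ 1 fun y : E => h (1, y) :=
    contDiffOn_univ.1 (hsmooth.comp (t := {ξ : ℝ × E | ξ ≠ 0}) (s := Set.univ)
      (contDiff_const.prodMk contDiff_id).contDiffOn fun y _ => by simp [Prod.ext_iff])
  obtain ⟨L, hL⟩ := hsection.exists_norm_le_mul_norm_of_map_zero (hvanish 1 one_pos)
  obtain ⟨M, hM⟩ := (isCompact_Icc.prod (isCompact_sphere (0 : E) 1) :
      IsCompact (Set.Icc (0 : ℝ) 1 ×ˢ Metric.sphere (0 : E) 1)).exists_bound_of_continuousOn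
    (hsmooth.continuousOn.mono fun ξ hξ h0 => by simp [h0] at hξ)
  have hscale : ∀ s : ℝ, 0 < s → ∀ t : ℝ, 0 < t → ∀ y : E,
      ‖h (t, y)‖ = s⁻¹ * ‖h (s⁻¹ * t, s⁻¹ • y)‖ := by
    intro s hs t ht y
    have hne : ((s⁻¹ * t, s⁻¹ • y) : ℝ × E) ≠ 0 := fun h0 =>
      (mul_pos (inv_pos.2 hs) ht).ne' (congrArg Prod.fst h0)
    have := hhom s hs _ hne
    rw [Prod.smul_mk, smul_smul, smul_eq_mul, mul_inv_cancel_left₀ hs.ne', mul_inv_cancel₀ hs.ne',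
      one_smul] at this
    rw [this, norm_mul, norm_inv, Complex.norm_real, Real.norm_of_nonneg hs.le]
  refine ⟨2 * max 0 (max L M), by positivity, fun t ht y => ?_⟩
  set K := max 0 (max L M)
  have hK : 0 ≤ K := le_max_left _ _
  have hLK : L ≤ K := (le_max_left _ _).trans (le_max_right _ _)
  have hMK : M ≤ K := (le_max_right _ _).trans (le_max_right _ _)
  rw [le_div_iff₀ (by positivity)]
  rcases le_total ‖y‖ t with hy | hy
  · have hnorm : ‖t⁻¹ • y‖ = t⁻¹ * ‖y‖ := by
      rw [norm_smul, norm_inv, Real.norm_of_nonneg ht.le]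
    have hbound := hL (t⁻¹ • y) (by rw [hnorm]; exact inv_mul_le_one_of_le₀ hy ht.le)
    rw [hscale t ht t ht y, inv_mul_cancel₀ ht.ne']
    calc t⁻¹ * ‖h (1, t⁻¹ • y)‖ * (t ^ 2 + ‖y‖ ^ 2)
        ≤ t⁻¹ * (K * (t⁻¹ * ‖y‖)) * (t ^ 2 + t ^ 2) := by
          rw [hnorm] at hbound
          gcongr
          exact hbound.trans (by gcongr)
      _ = 2 * K * ‖y‖ := by field_simp; ring
  · have hy0 : 0 < ‖y‖ := ht.trans_le hy
    have hbound := hM (‖y‖⁻¹ * t, ‖y‖⁻¹ • y)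
      ⟨⟨by positivity, inv_mul_le_one_of_le₀ hy hy0.le⟩, by
        simp [norm_smul, inv_mul_cancel₀ hy0.ne']⟩
    rw [hscale ‖y‖ hy0 t ht y]
    calc ‖y‖⁻¹ * ‖h (‖y‖⁻¹ * t, ‖y‖⁻¹ • y)‖ * (t ^ 2 + ‖y‖ ^ 2)
        ≤ ‖y‖⁻¹ * K * (‖y‖ ^ 2 + ‖y‖ ^ 2) := by
          gcongr
          exact hbound.trans hMK
      _ = 2 * K * ‖y‖ := by field_simp; ring

/-- Let `d ≥ 2` and `h : ℝ^d \ {0} → ℂ` be `C¹` and positively homogeneous of degree `−1`,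
vanishing on the positive `ξ₁`-axis.  Then there is `C` with
`‖h(ξ₁,ξ')‖ ≤ C‖ξ'‖/(ξ₁² + ‖ξ'‖²)` for `ξ₁ ≥ 2`, and `∫_2^∞ ‖h(ξ₁,ξ')‖ dξ₁ ≤ C‖ξ'‖`. -/
theorem homogeneous_minus_one_decay (d : ℕ) (hd : 2 ≤ d)
    (h : ℝ × EuclideanSpace ℝ (Fin (d - 1)) → ℂ)
    (hsmooth : ContDiffOn ℝ 1 h {ξ : ℝ × EuclideanSpace ℝ (Fin (d - 1)) | ξ ≠ 0})
    (hhom : ∀ s : ℝ, 0 < s → ∀ ξ : ℝ × EuclideanSpace ℝ (Fin (d - 1)), ξ ≠ 0 →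
      h (s • ξ) = (s : ℂ)⁻¹ * h ξ)
    (hvanish : ∀ ξ₁ : ℝ, 0 < ξ₁ → h (ξ₁, 0) = 0) :
    ∃ C : ℝ,
      (∀ ξ₁ : ℝ, 2 ≤ ξ₁ → ∀ ξ' : EuclideanSpace ℝ (Fin (d - 1)),
        ‖h (ξ₁, ξ')‖ ≤ C * ‖ξ'‖ / (ξ₁ ^ 2 + ‖ξ'‖ ^ 2)) ∧
      (∀ ξ' : EuclideanSpace ℝ (Fin (d - 1)),
        (∫ ξ₁ in Set.Ioi (2:ℝ), ‖h (ξ₁, ξ')‖) ≤ C * ‖ξ'‖) := by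
  obtain ⟨C, hC, hbound⟩ := exists_norm_le_mul_div_of_homogeneous hsmooth hhom hvanish
  refine ⟨C, fun t ht y => hbound t (by linarith) y, fun y => ?_⟩
  have hint : IntegrableOn (fun t : ℝ => t ^ (-2 : ℝ)) (Set.Ioi 2) :=
    integrableOn_Ioi_rpow_of_lt (by norm_num) two_pos
  calc ∫ t in Set.Ioi (2 : ℝ), ‖h (t, y)‖
      ≤ ∫ t in Set.Ioi (2 : ℝ), C * ‖y‖ * t ^ (-2 : ℝ) := by
        refine integral_mono_of_nonneg (.of_forall fun _ => norm_nonneg _) (hint.const_mul _)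
          ((ae_restrict_iff' measurableSet_Ioi).2 (.of_forall fun t ht => ?_))
        have ht0 : 0 < t := two_pos.trans ht
        refine (hbound t ht0 y).trans ?_
        beta_reduce
        rw [Real.rpow_neg ht0.le, Real.rpow_two, ← div_eq_mul_inv]
        gcongr
        exact le_add_of_nonneg_right (by positivity)
    _ = C * ‖y‖ * (1 / 2) := by
        rw [integral_const_mul, integral_Ioi_rpow_of_lt (by norm_num) two_pos]
        norm_num [Real.rpow_neg_one]
    _ ≤ C * ‖y‖ := mul_le_of_le_one_right (by positivity) (by norm_num)
end

section
/- Let d ≥ 2. Let χ : ℝ^d \ {0} → ℝ be smooth, positively homogeneous of degree 0 (χ(sξ) = χ(ξ) for s > 0), and even in the first variable (χ(−ξ₁, ξ') = χ(ξ₁, ξ')). Let φ : ℝ → ℝ be smooth and even with φ(s) = 0 for |s| ≤ 1 and φ(s) = 1 for |s| ≥ 2. Let a : ℝ^{d-1} → ℂ be a Schwartz function, let Q be a real quadratic form on ℝ^{d-1}, and let v ∈ ℝ^d. Then there is a constant C such that for every (t, x) ∈ ℝ × ℝ^d and every M ≥ 1, |∫_{ℝ^{d-1}} ∫_{-M}^{M}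 [χ(ξ₁, ξ') φ(ξ₁) a(ξ') / ξ₁] · exp( i ( x·ξ + t·( v·ξ + Q(ξ')/ξ₁ ) ) ) dξ₁ dξ'| ≤ C, where ξ = (ξ₁, ξ'). -/
open MeasureTheory intervalIntegral
open scoped RealInnerProductSpace

/-- If `F' - f` is dominated by the derivative of `G`, then `∫ f` is controlled by the increments
of `F` and `G`. -/
theorem abs_integral_le_of_abs_sub_deriv_le {A B : ℝ} (hAB : A ≤ B) {f F G F' G' : ℝ → ℝ}
    (hF : ∀ x ∈ Set.Icc A B, HasDerivAt F (F' x) x)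
    (hG : ∀ x ∈ Set.Icc A B, HasDerivAt G (G' x) x)
    (hf : ContinuousOn f (Set.Icc A B)) (hF' : ContinuousOn F' (Set.Icc A B))
    (hG' : ContinuousOn G' (Set.Icc A B))
    (h : ∀ x ∈ Set.Icc A B, |f x - F' x| ≤ G' x) :
    |∫ x in A..B, f x| ≤ |F B - F A| + (G B - G A) := by
  rw [← Set.uIcc_of_le hAB] at hF hG hf hF' hG'
  have e1 := intervalIntegral.integral_eq_sub_of_hasDerivAt hF hF'.intervalIntegrable
  have e2 := intervalIntegral.integral_eq_sub_of_hasDerivAt hG hG'.intervalIntegrable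
  have e3 := intervalIntegral.integral_sub (μ := volume) hf.intervalIntegrable
    hF'.intervalIntegrable
  have e4 : |∫ x in A..B, (f x - F' x)| ≤ ∫ x in A..B, G' x := by
    rw [← Real.norm_eq_abs]
    exact intervalIntegral.norm_integral_le_of_norm_le hAB
      (.of_forall fun x hx => h x ⟨hx.1.le, hx.2⟩) hG'.intervalIntegrable
  rw [e3, e1, e2] at e4
  have e5 := abs_add_le ((∫ x in A..B, f x) - (F B - F A)) (F B - F A)
  rw [sub_add_cancel] at e5
  linarith

/-- The sine integral is bounded. -/
theorem abs_integral_sinc_le_s5 (x : ℝ) : |∫ u in (0 : ℝ)..x, Real.sinc u| ≤ 4 := by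
  have hi (a b : ℝ) : IntervalIntegrable Real.sinc volume a b :=
    Real.continuous_sinc.intervalIntegrable a b
  have small (y : ℝ) (h0 : 0 ≤ y) (h1 : y ≤ 1) : |∫ u in (0 : ℝ)..y, Real.sinc u| ≤ 1 := by
    have := intervalIntegral.norm_integral_le_of_norm_le_const (a := 0) (b := y) (f := Real.sinc)
      (C := 1) fun u _ => Real.abs_sinc_le_one u
    rw [sub_zero, abs_of_nonneg h0, one_mul] at this
    exact this.trans h1
  have pos (y : ℝ) (h0 : 0 ≤ y) : |∫ u in (0 : ℝ)..y, Real.sinc u| ≤ 4 := by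
    rcases le_total y 1 with h1 | h1
    · linarith [small y h0 h1]
    have hne (u : ℝ) (hu : u ∈ Set.Icc 1 y) : u ≠ 0 := by linarith [hu.1]
    have key : |∫ u in (1 : ℝ)..y, Real.sinc u| ≤ |-Real.cos y / y - -Real.cos 1 / 1| +
        (-1 / y - -1 / 1) := by
      refine abs_integral_le_of_abs_sub_deriv_le (F := fun u => -Real.cos u / u)
        (G := fun u => -1 / u) (F' := fun u => Real.sin u / u + Real.cos u / u ^ 2)
        (G' := fun u => 1 / u ^ 2) h1 ?_ ?_ Real.continuous_sinc.continuousOn ?_ ?_ ?_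
      · intro u hu
        have := ((Real.hasDerivAt_cos u).neg).div (hasDerivAt_id u) (hne u hu)
        convert! this using 1
        have := hne u hu
        simp only [Pi.neg_apply, id]
        field_simp
        ring
      · intro u hu
        convert! (hasDerivAt_const u (-1 : ℝ)).div (hasDerivAt_id u) (hne u hu) using 1
        simp
      · exact (Real.continuous_sin.continuousOn.div continuousOn_id hne).add
          (Real.continuous_cos.continuousOn.div (continuousOn_id.pow 2)
            fun u hu => pow_ne_zero 2 (hne u hu))
      · exact continuousOn_const.div (continuousOn_id.pow 2) fun u hu => pow_ne_zero 2 (hne u hu)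
      · intro u hu
        rw [Real.sinc_of_ne_zero (hne u hu), sub_add_cancel_left, abs_neg, abs_div,
          abs_of_nonneg (sq_nonneg u)]
        gcongr
        exact Real.abs_cos_le_one u
    have hy : 0 < y := by linarith
    have b1 : |-Real.cos y / y| ≤ 1 := by
      rw [abs_div, abs_neg, abs_of_pos hy]
      exact div_le_one_of_le₀ ((Real.abs_cos_le_one y).trans h1) hy.le
    have b2 : |-Real.cos 1 / 1| ≤ 1 := by
      rw [div_one, abs_neg]
      exact Real.abs_cos_le_one 1
    have b3 : -1 / y ≤ 0 := div_nonpos_of_nonpos_of_nonneg (by norm_num) hy.le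
    rw [← intervalIntegral.integral_add_adjacent_intervals (hi 0 1) (hi 1 y)]
    have b4 := abs_sub (-Real.cos y / y) (-Real.cos 1 / 1)
    have b5 := abs_add_le (∫ u in (0 : ℝ)..1, Real.sinc u) (∫ u in (1 : ℝ)..y, Real.sinc u)
    linarith [small 1 zero_le_one le_rfl]
  rcases le_total 0 x with h | h
  · exact pos x h
  · have e := intervalIntegral.integral_comp_neg (a := 0) (b := -x) Real.sinc
    simp only [Real.sinc_neg, neg_neg, neg_zero] at e
    rw [intervalIntegral.integral_symm, ← e, abs_neg]
    exact pos (-x) (by linarith)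

theorem hasDerivAt_mul_add_div (α β : ℝ) {r : ℝ} (hr : r ≠ 0) :
    HasDerivAt (fun r => α * r + β / r) (α - β / r ^ 2) r := by
  convert! ((hasDerivAt_id r).const_mul α).add ((hasDerivAt_const r β).div (hasDerivAt_id r) hr)
    using 1
  simp
  ring

theorem continuousOn_sin_mul_add_div (α β : ℝ) :
    ContinuousOn (fun r : ℝ => Real.sin (α * r + β / r) / r) {r | r ≠ 0} := by
  have h (r : ℝ) (hr : r ∈ {r : ℝ | r ≠ 0}) : r ≠ 0 := hr
  fun_prop (disch := assumption)

theorem hasDerivAt_integral_sinc_comp (α β : ℝ) {r : ℝ} (hr : r ≠ 0) :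
    HasDerivAt (fun r => ∫ u in (0 : ℝ)..(α * r + β / r), Real.sinc u)
      (Real.sinc (α * r + β / r) * (α - β / r ^ 2)) r :=
  HasDerivAt.comp (h₂ := fun x => ∫ u in (0 : ℝ)..x, Real.sinc u) r
    (Real.continuous_sinc.integral_hasStrictDerivAt 0 (α * r + β / r)).hasDerivAt
    (hasDerivAt_mul_add_div α β hr)

theorem continuousOn_sinc_mul_add_div (α β : ℝ) :
    ContinuousOn (fun r : ℝ => Real.sinc (α * r + β / r) * (α - β / r ^ 2)) {r | r ≠ 0} := by
  have h (r : ℝ) (hr : r ∈ {r : ℝ | r ≠ 0}) : r ≠ 0 := hr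
  have h2 (r : ℝ) (hr : r ∈ {r : ℝ | r ≠ 0}) : r ^ 2 ≠ 0 := pow_ne_zero 2 hr
  have : ContinuousOn (fun r : ℝ => α * r + β / r) {r | r ≠ 0} := by
    fun_prop (disch := assumption)
  refine (Real.continuous_sinc.comp_continuousOn this).mul ?_
  fun_prop (disch := assumption)

theorem abs_sub_integral_sinc_le (x y : ℝ) :
    |(∫ u in (0 : ℝ)..x, Real.sinc u) - ∫ u in (0 : ℝ)..y, Real.sinc u| ≤ 8 := by
  have := abs_sub (∫ u in (0 : ℝ)..x, Real.sinc u) (∫ u in (0 : ℝ)..y, Real.sinc u)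
  linarith [abs_integral_sinc_le_s5 x, abs_integral_sinc_le_s5 y]

/-- Oscillatory integral in the range where the linear part of the phase dominates. -/
theorem abs_integral_sin_le_of_linear_dominates {α β A B : ℝ} (hα : α ≠ 0) (hA : 0 < A)
    (hAB : A ≤ B) (h : 4 * |β| ≤ |α| * A ^ 2) :
    |∫ r in A..B, Real.sin (α * r + β / r) / r| ≤ 9 := by
  have hpos (r : ℝ) (hr : r ∈ Set.Icc A B) : 0 < r := hA.trans_le hr.1
  have hsub : Set.Icc A B ⊆ {r | r ≠ 0} := fun r hr => (hpos r hr).ne'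
  have hα' : 0 < |α| := abs_pos.2 hα
  have key := abs_integral_le_of_abs_sub_deriv_le hAB
    (f := fun r => Real.sin (α * r + β / r) / r)
    (G := fun r => -(4 / 3 * |β| / |α|) / r ^ 2) (G' := fun r => 8 / 3 * |β| / |α| / r ^ 3)
    (fun r hr => hasDerivAt_integral_sinc_comp α β (hsub hr)) ?_
    ((continuousOn_sin_mul_add_div α β).mono hsub)
    ((continuousOn_sinc_mul_add_div α β).mono hsub) ?_ ?_
  · refine key.trans ?_
    have b1 := abs_sub_integral_sinc_le (α * B + β / B) (α * A + β / A)
    have b2 : -(4 / 3 * |β| / |α|) / B ^ 2 ≤ 0 :=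
      div_nonpos_of_nonpos_of_nonneg (neg_nonpos.2 (by positivity)) (by positivity)
    have b3 : -(4 / 3 * |β| / |α|) / A ^ 2 ≥ -1 := by
      rw [neg_div, div_div, ge_iff_le, neg_le_neg_iff]
      exact div_le_one_of_le₀ (by linarith [abs_nonneg β]) (by positivity)
    linarith
  · intro r hr
    have hr0 : r ≠ 0 := hsub hr
    convert! (hasDerivAt_const r (-(4 / 3 * |β| / |α|))).div (hasDerivAt_pow 2 r)
      (pow_ne_zero 2 hr0) using 1
    simp
    field_simp
    ring
  · exact continuousOn_const.div (continuousOn_id.pow 3) fun u hu => pow_ne_zero 3 (hsub hu)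
  · intro r hr
    have hr0 := hpos r hr
    have hβ : 4 * |β| ≤ |α| * r ^ 2 := by
      have : A ^ 2 ≤ r ^ 2 := by gcongr; exact hr.1
      nlinarith
    have hθ : 3 / 4 * (|α| * r ^ 2) ≤ |α * r ^ 2 + β| := by
      have := abs_sub_abs_le_abs_sub (α * r ^ 2) (-β)
      rw [abs_mul, abs_neg, sub_neg_eq_add, abs_of_nonneg (sq_nonneg r)] at this
      linarith
    have hαr : 0 < |α| * r ^ 2 := by positivity
    have hne : α * r ^ 2 + β ≠ 0 := abs_pos.1 (by linarith)
    have e : α * r + β / r = (α * r ^ 2 + β) / r := by field_simp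
    have hne' : α * r + β / r ≠ 0 := by rw [e]; exact div_ne_zero hne hr0.ne'
    have e2 : Real.sin (α * r + β / r) / r - Real.sinc (α * r + β / r) * (α - β / r ^ 2) =
        Real.sin (α * r + β / r) * (2 * β / (r * (α * r ^ 2 + β))) := by
      rw [Real.sinc_of_ne_zero hne']
      generalize Real.sin (α * r + β / r) = S
      rw [e]
      generalize hN : α * r ^ 2 + β = N at hne ⊢
      obtain rfl : β = N - α * r ^ 2 := by linarith
      field_simp
      ring
    rw [e2, abs_mul]
    refine (mul_le_of_le_one_left (abs_nonneg _) (Real.abs_sin_le_one _)).trans ?_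
    rw [abs_div, abs_mul, abs_mul, abs_of_pos hr0, abs_two, div_div,
      div_le_div_iff₀ (by positivity) (by positivity)]
    have := mul_le_mul_of_nonneg_left hθ (by positivity : 0 ≤ |β| * r)
    nlinarith

/-- Oscillatory integral in the range where the singular part of the phase dominates. -/
theorem abs_integral_sin_le_of_inv_dominates {α β A B : ℝ} (hβ : β ≠ 0) (hA : 0 < A)
    (hAB : A ≤ B) (h : 4 * (|α| * B ^ 2) ≤ |β|) :
    |∫ r in A..B, Real.sin (α * r + β / r) / r| ≤ 9 := by
  have hpos (r : ℝ) (hr : r ∈ Set.Icc A B) : 0 < r := hA.trans_le hr.1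
  have hsub : Set.Icc A B ⊆ {r | r ≠ 0} := fun r hr => (hpos r hr).ne'
  have hβ' : 0 < |β| := abs_pos.2 hβ
  have key := abs_integral_le_of_abs_sub_deriv_le hAB
    (f := fun r => Real.sin (α * r + β / r) / r)
    (G := fun r => 4 / 3 * |α| / |β| * r ^ 2) (G' := fun r => 8 / 3 * |α| / |β| * r)
    (fun r hr => (hasDerivAt_integral_sinc_comp α β (hsub hr)).neg) ?_
    ((continuousOn_sin_mul_add_div α β).mono hsub)
    ((continuousOn_sinc_mul_add_div α β).mono hsub).neg ?_ ?_
  · refine key.trans ?_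
    have b1 := abs_sub_integral_sinc_le (α * A + β / A) (α * B + β / B)
    have b2 : 0 ≤ 4 / 3 * |α| / |β| * A ^ 2 := by positivity
    have b3 : 4 / 3 * |α| / |β| * B ^ 2 ≤ 1 := by
      rw [div_mul_eq_mul_div]
      exact div_le_one_of_le₀ (by nlinarith [abs_nonneg α, sq_nonneg B]) (by positivity)
    simp only [Pi.neg_apply, neg_sub_neg]
    linarith
  · intro r hr
    convert! (hasDerivAt_pow 2 r).const_mul (4 / 3 * |α| / |β|) using 1
    simp
    ring
  · fun_prop
  · intro r hr
    have hr0 := hpos r hr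
    have hα : 4 * (|α| * r ^ 2) ≤ |β| := by
      have : r ^ 2 ≤ B ^ 2 := by gcongr; exact hr.2
      nlinarith [abs_nonneg α]
    have hθ : 3 / 4 * |β| ≤ |α * r ^ 2 + β| := by
      have := abs_sub_abs_le_abs_sub β (-(α * r ^ 2))
      rw [abs_neg, abs_mul, sub_neg_eq_add, abs_of_nonneg (sq_nonneg r), add_comm β] at this
      linarith
    have hne : α * r ^ 2 + β ≠ 0 := abs_pos.1 (by linarith)
    have e : α * r + β / r = (α * r ^ 2 + β) / r := by field_simp
    have hne' : α * r + β / r ≠ 0 := by rw [e]; exact div_ne_zero hne hr0.ne'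
    have e2 : Real.sin (α * r + β / r) / r - -(Real.sinc (α * r + β / r) * (α - β / r ^ 2)) =
        Real.sin (α * r + β / r) * (2 * α * r / (α * r ^ 2 + β)) := by
      rw [Real.sinc_of_ne_zero hne']
      generalize Real.sin (α * r + β / r) = S
      rw [e]
      generalize hN : α * r ^ 2 + β = N at hne ⊢
      obtain rfl : β = N - α * r ^ 2 := by linarith
      field_simp
      ring
    rw [e2, abs_mul]
    refine (mul_le_of_le_one_left (abs_nonneg _) (Real.abs_sin_le_one _)).trans ?_
    rw [abs_div, abs_mul, abs_mul, abs_of_pos hr0, abs_two, div_mul_eq_mul_div,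
      div_le_div_iff₀ (by linarith) hβ']
    have := mul_le_mul_of_nonneg_left hθ (by positivity : 0 ≤ |α| * r)
    nlinarith

/-- Uniform bound for the oscillatory integral of `sin (α r + β / r) / r`. -/
theorem abs_integral_sin_mul_add_div_le (α β : ℝ) {A B : ℝ} (hA : 0 < A) (hB : 0 < B) :
    |∫ r in A..B, Real.sin (α * r + β / r) / r| ≤ 20 := by
  wlog hAB : A ≤ B generalizing A B
  · rw [intervalIntegral.integral_symm, abs_neg]
    exact this hB hA (le_of_not_ge hAB)
  by_cases hα : α = 0
  · by_cases hβ : β = 0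
    · simp [hα, hβ]
    · exact (abs_integral_sin_le_of_inv_dominates hβ hA hAB (by simp [hα])).trans (by norm_num)
  by_cases hβ : β = 0
  · exact (abs_integral_sin_le_of_linear_dominates hα hA hAB
      (by simp only [hβ, abs_zero, mul_zero]; positivity)).trans (by norm_num)
  have hα' : 0 < |α| := abs_pos.2 hα
  have hβ' : 0 < |β| := abs_pos.2 hβ
  obtain ⟨ρ, hρ, hρe⟩ : ∃ ρ : ℝ, 0 < ρ ∧ |α| * ρ ^ 2 = |β| := by
    refine ⟨√(|β| / |α|), by positivity, ?_⟩
    rw [Real.sq_sqrt (by positivity)]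
    field_simp
  have hi {a b : ℝ} (ha : 0 < a) (hb : 0 < b) :
      IntervalIntegrable (fun r => Real.sin (α * r + β / r) / r) volume a b :=
    ((continuousOn_sin_mul_add_div α β).mono fun r hr => ((lt_min ha hb).trans_le hr.1).ne'
      ).intervalIntegrable
  have mid {a b : ℝ} (ha : 0 < a) (hab : a ≤ b) (hb : b ≤ 2 * a) :
      |∫ r in a..b, Real.sin (α * r + β / r) / r| ≤ 1 := by
    have := intervalIntegral.norm_integral_le_of_norm_le_const (a := a) (b := b)
      (f := fun r => Real.sin (α * r + β / r) / r) (C := 1 / a) fun r hr => by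
        rw [Set.uIoc_of_le hab] at hr
        have hr0 : 0 < r := ha.trans hr.1
        rw [norm_div, Real.norm_eq_abs, Real.norm_eq_abs, abs_of_pos hr0]
        exact div_le_div₀ zero_le_one (Real.abs_sin_le_one _) ha hr.1.le
    rw [abs_of_nonneg (sub_nonneg.2 hab), Real.norm_eq_abs] at this
    refine this.trans ?_
    rw [one_div_mul_eq_div]
    exact div_le_one_of_le₀ (by linarith) ha.le
  have from_ρ {X : ℝ} (hX : 0 < X) : |∫ r in ρ..X, Real.sin (α * r + β / r) / r| ≤ 10 := by
    rcases le_total ρ X with h | h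
    · rcases le_total X (2 * ρ) with h2 | h2
      · exact (mid hρ h h2).trans (by norm_num)
      · rw [← intervalIntegral.integral_add_adjacent_intervals (hi hρ (by positivity : 0 < 2 * ρ))
          (hi (by positivity) hX)]
        have b1 := mid hρ (by linarith : ρ ≤ 2 * ρ) le_rfl
        have b2 := abs_integral_sin_le_of_linear_dominates (β := β) hα
          (by positivity : 0 < 2 * ρ) h2 (by nlinarith)
        exact (abs_add_le _ _).trans (by linarith)
    · rw [intervalIntegral.integral_symm, abs_neg]
      rcases le_total (ρ / 2) X with h2 | h2
      · exact (mid hX h (by linarith)).trans (by norm_num)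
      · rw [← intervalIntegral.integral_add_adjacent_intervals (hi hX (by positivity : 0 < ρ / 2))
          (hi (by positivity) hρ)]
        have b1 := mid (by positivity : 0 < ρ / 2) (by linarith : ρ / 2 ≤ ρ) (by linarith)
        have b2 := abs_integral_sin_le_of_inv_dominates (α := α) hβ hX h2 (by nlinarith)
        exact (abs_add_le _ _).trans (by linarith)
  rw [← intervalIntegral.integral_add_adjacent_intervals (hi hA hρ) (hi hρ hB),
    intervalIntegral.integral_symm]
  refine (abs_add_le _ _).trans ?_
  rw [abs_neg]
  linarith [from_ρ hA, from_ρ hB]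

/-- Uniform bound for the oscillatory integral with a slowly varying amplitude `h` and a bounded
cutoff `φ` equal to `1` on `[2, ∞)`. -/
theorem abs_integral_amplitude_mul_sin_le {h φ : ℝ → ℝ} {K L D : ℝ}
    (hh : ContDiffOn ℝ 1 h (Set.Ioi 0)) (hK : ∀ s, 0 < s → |h s| ≤ K)
    (hL : ∀ s, 0 < s → |deriv h s| ≤ L / s ^ 2)
    (hφ : Continuous φ) (hφ1 : ∀ s, 2 ≤ s → φ s = 1) (hD : ∀ s ∈ Set.Icc (1 : ℝ) 2, |φ s| ≤ D)
    (α β : ℝ) {M : ℝ} (hM : 1 ≤ M) :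
    |∫ s in (1 : ℝ)..M, h s * φ s * (Real.sin (α * s + β / s) / s)| ≤
      K * D + 20 * K + 20 * L := by
  set S : ℝ → ℝ := fun s => Real.sin (α * s + β / s) / s with hS
  have hScont : ContinuousOn S (Set.Ioi 0) :=
    (continuousOn_sin_mul_add_div α β).mono fun s hs => (Set.mem_Ioi.1 hs).ne'
  have hK0 : 0 ≤ K := (abs_nonneg _).trans (hK 1 one_pos)
  have hL0 : 0 ≤ L := by simpa using (abs_nonneg _).trans (hL 1 one_pos)
  have hcont : ContinuousOn (fun s => h s * φ s * S s) (Set.Ioi 0) :=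
    (hh.continuousOn.mul hφ.continuousOn).mul hScont
  have small {b : ℝ} (h1 : 1 ≤ b) (h2 : b ≤ 2) :
      |∫ s in (1 : ℝ)..b, h s * φ s * S s| ≤ K * D := by
    have hD0 : 0 ≤ D := (abs_nonneg _).trans (hD 1 (by norm_num))
    have := intervalIntegral.norm_integral_le_of_norm_le_const (a := 1) (b := b)
      (f := fun s => h s * φ s * S s) (C := K * D) fun s hs => by
        rw [Set.uIoc_of_le h1] at hs
        have hs0 : 0 < s := one_pos.trans hs.1
        have hS1 : |S s| ≤ 1 := by
          rw [hS, abs_div, abs_of_pos hs0]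
          exact div_le_one_of_le₀ ((Real.abs_sin_le_one _).trans hs.1.le) hs0.le
        rw [Real.norm_eq_abs, abs_mul, abs_mul]
        refine (mul_le_of_le_one_right (by positivity) hS1).trans ?_
        exact mul_le_mul (hK s hs0) (hD s ⟨hs.1.le, hs.2.trans h2⟩) (abs_nonneg _) hK0
    rw [abs_of_nonneg (sub_nonneg.2 h1), Real.norm_eq_abs] at this
    exact this.trans (mul_le_of_le_one_right (by positivity) (by linarith))
  rcases le_total M 2 with h2 | h2
  · linarith [small hM h2]
  have hpos (s : ℝ) (hs : s ∈ Set.Icc 2 M) : 0 < s := by linarith [hs.1]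
  have hsub : Set.Icc 2 M ⊆ Set.Ioi 0 := hpos
  have hΦ (s : ℝ) (hs : s ∈ Set.Icc 2 M) :
      HasDerivAt (fun x => ∫ r in (2 : ℝ)..x, S r) (S s) s := by
    refine intervalIntegral.integral_hasDerivAt_right ?_ ?_ ?_
    · refine (hScont.mono fun r hr => ?_).intervalIntegrable
      exact (lt_min two_pos (hpos s hs)).trans_le hr.1
    · exact hScont.stronglyMeasurableAtFilter isOpen_Ioi s (hpos s hs)
    · exact hScont.continuousAt (Ioi_mem_nhds (hpos s hs))
  have hh' (s : ℝ) (hs : s ∈ Set.Icc 2 M) : HasDerivAt h (deriv h s) s :=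
    ((hh.differentiableOn one_ne_zero).differentiableAt (Ioi_mem_nhds (hpos s hs))).hasDerivAt
  have large : |∫ s in (2 : ℝ)..M, h s * φ s * S s| ≤ 20 * K + 20 * L := by
    have key := abs_integral_le_of_abs_sub_deriv_le h2 (f := fun s => h s * φ s * S s)
      (G := fun s => -(20 * L) / s) (G' := fun s => 20 * L / s ^ 2)
      (fun s hs => (hh' s hs).mul (hΦ s hs)) ?_ (hcont.mono hsub) ?_ ?_ ?_
    · have b1 : |(h * fun x => ∫ r in (2 : ℝ)..x, S r) M| ≤ 20 * K := by
        rw [Pi.mul_apply, abs_mul, mul_comm]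
        exact mul_le_mul (abs_integral_sin_mul_add_div_le α β two_pos (by linarith))
          (hK M (by linarith)) (abs_nonneg _) (by norm_num)
      have b2 : (h * fun x => ∫ r in (2 : ℝ)..x, S r) 2 = 0 := by simp
      rw [b2, sub_zero] at key
      have b3 : -(20 * L) / M ≤ 0 :=
        div_nonpos_of_nonpos_of_nonneg (by linarith) (by linarith)
      linarith
    · intro s hs
      convert! (hasDerivAt_const s (-(20 * L))).div (hasDerivAt_id s) (hpos s hs).ne' using 1
      simp
    · refine ContinuousOn.add (ContinuousOn.mul ?_ ?_) (ContinuousOn.mul ?_ ?_)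
      · exact (hh.continuousOn_deriv_of_isOpen isOpen_Ioi le_rfl).mono hsub
      · exact fun s hs => (hΦ s hs).continuousAt.continuousWithinAt
      · exact hh.continuousOn.mono hsub
      · exact hScont.mono hsub
    · exact continuousOn_const.div (continuousOn_id.pow 2)
        fun s hs => pow_ne_zero 2 (hpos s hs).ne'
    · intro s hs
      rw [hφ1 s hs.1, mul_one, sub_add_cancel_right, abs_neg, abs_mul, mul_comm, mul_div_assoc]
      exact mul_le_mul (abs_integral_sin_mul_add_div_le α β two_pos (hpos s hs))
        (hL s (hpos s hs)) (abs_nonneg _) (by norm_num)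
  have hi {a b : ℝ} (ha : 0 < a) (hb : 0 < b) :
      IntervalIntegrable (fun s => h s * φ s * S s) volume a b :=
    (hcont.mono fun r hr => (lt_min ha hb).trans_le hr.1).intervalIntegrable
  rw [← intervalIntegral.integral_add_adjacent_intervals (hi one_pos two_pos)
    (hi two_pos (by linarith))]
  refine (abs_add_le _ _).trans ?_
  linarith [small one_le_two le_rfl]

section Homogeneous

variable {E : Type*} [NormedAddCommGroup E] [NormedSpace ℝ E] [FiniteDimensional ℝ E]

/-- A continuous function that is homogeneous of degree zero is bounded away from the origin. -/
theorem exists_bound_of_homogeneous_zero {f : E → ℝ} (hf : ContinuousOn f {ξ | ξ ≠ 0})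
    (hhom : ∀ s : ℝ, 0 < s → ∀ ξ, f (s • ξ) = f ξ) : ∃ K, ∀ ξ ≠ 0, |f ξ| ≤ K := by
  have : ProperSpace E := FiniteDimensional.proper_real E
  obtain ⟨K, hK⟩ := (isCompact_sphere (0 : E) 1).exists_bound_of_continuousOn
    (hf.mono fun ξ hξ => ne_zero_of_mem_unit_sphere ⟨ξ, hξ⟩)
  refine ⟨K, fun ξ hξ => ?_⟩
  rw [← hhom ‖ξ‖⁻¹ (by positivity) ξ]
  exact hK _ (by simp [norm_smul, hξ])

/-- The derivative of a function that is homogeneous of degree zero is bounded away from the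
origin by a multiple of `‖ξ‖⁻¹`. -/
theorem exists_fderiv_bound_of_homogeneous_zero {f : E → ℝ}
    (hf : ContDiffOn ℝ 1 f {ξ | ξ ≠ 0})
    (hhom : ∀ s : ℝ, 0 < s → ∀ ξ, f (s • ξ) = f ξ) :
    ∃ L, 0 ≤ L ∧ ∀ ξ ≠ 0, ‖fderiv ℝ f ξ‖ ≤ L * ‖ξ‖⁻¹ := by
  have : ProperSpace E := FiniteDimensional.proper_real E
  obtain ⟨L, hL⟩ := (isCompact_sphere (0 : E) 1).exists_bound_of_continuousOn
    ((hf.continuousOn_fderiv_of_isOpen isOpen_ne le_rfl).mono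
      fun ξ hξ => ne_zero_of_mem_unit_sphere ⟨ξ, hξ⟩)
  refine ⟨max L 0, le_max_right _ _, fun ξ hξ => ?_⟩
  have hpos : 0 < ‖ξ‖⁻¹ := by positivity
  have e := fderiv_comp_smul (𝕜 := ℝ) (f := f) (x := ξ) ‖ξ‖⁻¹
  simp only [hhom _ hpos] at e
  rw [e, norm_smul, norm_inv, norm_norm, mul_comm]
  gcongr
  exact (hL _ (by simp [norm_smul, hξ])).trans (le_max_left _ _)

/-- Decay of the derivative of a function that is homogeneous of degree zero along the rays
`s ↦ (s, y)`. -/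
theorem exists_deriv_bound_of_homogeneous_zero {f : ℝ × E → ℝ}
    (hf : ContDiffOn ℝ 1 f {ξ | ξ ≠ 0})
    (hhom : ∀ s : ℝ, 0 < s → ∀ ξ, f (s • ξ) = f ξ) :
    ∃ L, ∀ (y : E) (s : ℝ), 0 < s → |deriv (fun s => f (s, y)) s| ≤ L * ‖y‖ / s ^ 2 := by
  obtain ⟨L, hL0, hL⟩ := exists_fderiv_bound_of_homogeneous_zero hf hhom
  refine ⟨L, fun y s hs => ?_⟩
  have hne : ((1, s⁻¹ • y) : ℝ × E) ≠ 0 := fun h => one_ne_zero (congrArg Prod.fst h)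
  have hev : (fun s => f (s, y)) =ᶠ[nhds s] fun s => f (1, s⁻¹ • y) := by
    filter_upwards [Ioi_mem_nhds hs] with r hr
    rw [← hhom r⁻¹ (inv_pos.2 hr) (r, y), Prod.smul_mk, smul_eq_mul,
      inv_mul_cancel₀ (Set.mem_Ioi.1 hr).ne']
  have hd : HasDerivAt (fun s : ℝ => ((1, s⁻¹ • y) : ℝ × E)) (0, (-(s ^ 2)⁻¹) • y) s :=
    (hasDerivAt_const s (1 : ℝ)).prodMk ((hasDerivAt_inv hs.ne').smul_const y)
  have hfd : DifferentiableAt ℝ f (1, s⁻¹ • y) :=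
    (hf.differentiableOn one_ne_zero).differentiableAt (isOpen_ne.mem_nhds hne)
  have hd2 : HasDerivAt (fun s => f (1, s⁻¹ • y))
      (fderiv ℝ f (1, s⁻¹ • y) (0, (-(s ^ 2)⁻¹) • y)) s :=
    hfd.hasFDerivAt.comp_hasDerivAt s hd
  rw [hev.deriv_eq, hd2.deriv, ← Real.norm_eq_abs]
  refine (ContinuousLinearMap.le_opNorm _ _).trans ?_
  have h1 : ‖fderiv ℝ f (1, s⁻¹ • y)‖ ≤ L := by
    refine (hL _ hne).trans (mul_le_of_le_one_right hL0 (inv_le_one_of_one_le₀ ?_))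
    simp
  have h2 : ‖((0, (-(s ^ 2)⁻¹) • y) : ℝ × E)‖ = ‖y‖ / s ^ 2 := by
    rw [Prod.norm_mk, norm_zero, max_eq_right (norm_nonneg _), norm_smul, norm_neg, norm_inv,
      norm_pow, Real.norm_eq_abs, sq_abs, inv_mul_eq_div]
  rw [h2, mul_div_assoc]
  gcongr

end Homogeneous

/-- Folding the symmetric integral of an even amplitude against `exp (i (αs + β / s)) / s`. -/
theorem integral_symm_amplitude_mul_exp {g : ℝ → ℝ} (hgc : ContinuousOn g {s | s ≠ 0})
    (hg0 : ∀ s, |s| ≤ 1 → g s = 0) (hge : ∀ s, g (-s) = g s) (α β γ : ℝ) (z : ℂ) {M : ℝ}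
    (hM : 1 ≤ M) :
    ∫ s in (-M)..M, ((g s : ℂ) * z / (s : ℂ)) *
        Complex.exp (Complex.I * ((α * s + γ + β / s : ℝ) : ℂ)) =
      2 * Complex.I * z * Complex.exp (Complex.I * γ) *
        ((∫ s in (1 : ℝ)..M, g s * (Real.sin (α * s + β / s) / s) : ℝ) : ℂ) := by
  set F : ℝ → ℂ := fun s => ((g s : ℂ) * z / (s : ℂ)) *
        Complex.exp (Complex.I * ((α * s + γ + β / s : ℝ) : ℂ)) with hF
  have hcont : Continuous F := by
    refine continuous_iff_continuousAt.2 fun s => ?_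
    by_cases hs : s = 0
    · have : F =ᶠ[nhds s] fun _ => 0 := by
        subst hs
        filter_upwards [Metric.ball_mem_nhds (0 : ℝ) one_pos] with r hr
        simp [hF, hg0 r (by simpa using (mem_ball_zero_iff.1 hr).le)]
      exact this.continuousAt
    · have h1 : ContinuousAt g s := hgc.continuousAt (isOpen_ne.mem_nhds hs)
      have h2 : (s : ℂ) ≠ 0 := by exact_mod_cast hs
      have h3 : ContinuousAt (fun s : ℝ => α * s + γ + β / s) s := by
        fun_prop (disch := assumption)
      have h4 : ContinuousAt (fun s : ℝ => ((α * s + γ + β / s : ℝ) : ℂ)) s :=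
        Complex.continuous_ofReal.continuousAt.comp h3
      have h5 : ContinuousAt (fun s : ℝ => (g s : ℂ)) s :=
        Complex.continuous_ofReal.continuousAt.comp h1
      exact ((h5.mul continuousAt_const).div Complex.continuous_ofReal.continuousAt h2).mul
        (continuousAt_const.mul h4).cexp
  have hi (a b : ℝ) : IntervalIntegrable F volume a b := hcont.intervalIntegrable a b
  have hneg : ∫ s in (-M)..0, F s = ∫ s in (0 : ℝ)..M, F (-s) := by
    simp [intervalIntegral.integral_comp_neg]
  have hcn : Continuous fun s => F s + F (-s) := hcont.add (hcont.comp continuous_neg)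
  have hsum : ∫ s in (-M)..M, F s = ∫ s in (0 : ℝ)..M, (F s + F (-s)) := by
    rw [← intervalIntegral.integral_add_adjacent_intervals (hi (-M) 0) (hi 0 M), hneg, add_comm]
    exact (intervalIntegral.integral_add (hi 0 M)
      ((hcont.comp continuous_neg).intervalIntegrable 0 M)).symm
  have hzero : ∫ s in (0 : ℝ)..1, (F s + F (-s)) = 0 := by
    rw [intervalIntegral.integral_congr (g := fun _ => 0)]
    · simp
    · intro s hs
      rw [Set.uIcc_of_le zero_le_one] at hs
      simp [hF, hge, hg0 s (abs_le.2 ⟨by linarith [hs.1], hs.2⟩)]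
  rw [hsum, ← intervalIntegral.integral_add_adjacent_intervals (hcn.intervalIntegrable 0 1)
    (hcn.intervalIntegrable 1 M), hzero, zero_add, ← intervalIntegral.integral_ofReal,
    ← intervalIntegral.integral_const_mul]
  refine intervalIntegral.integral_congr fun s hs => ?_
  rw [Set.uIcc_of_le hM] at hs
  have hs0 : (s : ℂ) ≠ 0 := by exact_mod_cast (one_pos.trans_le hs.1).ne'
  have e1 : Complex.I * ((α * s + γ + β / s : ℝ) : ℂ) =
      Complex.I * γ + ((α * s + β / s : ℝ) : ℂ) * Complex.I := by push_cast; ring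
  have e2 : Complex.I * ((α * -s + γ + β / -s : ℝ) : ℂ) =
      Complex.I * γ + -((α * s + β / s : ℝ) : ℂ) * Complex.I := by
    rw [div_neg]; push_cast; ring
  simp only [hF, hge]
  rw [e1, e2, Complex.exp_add, Complex.exp_add, Complex.ofReal_mul, Complex.ofReal_div,
    Complex.ofReal_sin, Complex.sin]
  generalize Complex.exp (((α * s + β / s : ℝ) : ℂ) * Complex.I) = P
  generalize Complex.exp (-((α * s + β / s : ℝ) : ℂ) * Complex.I) = N
  push_cast
  field_simp
  linear_combination (-(g s : ℂ) * z * (N - P)) * Complex.I_sq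

/-- Uniform boundedness (in the truncation `M ≥ 1` and in `(t,x)`) of the paraxial
approximation: with `χ` homogeneous of degree `0`, smooth away from `0` and even in `ξ₁`,
`φ` an even smooth cutoff vanishing for `|s| ≤ 1` and equal to `1` for `|s| ≥ 2`,
`a` Schwartz, `Q` a real quadratic form and `v ∈ ℝ^d`, the truncated principal-value
integrals of `χ φ a / ξ₁ · exp(i(x·ξ + t(v·ξ + Q(ξ')/ξ₁)))` are uniformly bounded. -/
theorem paraxial_truncated_integral_bounded (d : ℕ) (hd : 2 ≤ d)
    (χ : ℝ × EuclideanSpace ℝ (Fin (d - 1)) → ℝ)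
    (hχ : ContDiffOn ℝ (⊤ : ℕ∞) χ {ξ : ℝ × EuclideanSpace ℝ (Fin (d - 1)) | ξ ≠ 0})
    (hχhom : ∀ s : ℝ, 0 < s → ∀ ξ : ℝ × EuclideanSpace ℝ (Fin (d - 1)), χ (s • ξ) = χ ξ)
    (hχeven : ∀ (ξ₁ : ℝ) (ξ' : EuclideanSpace ℝ (Fin (d - 1))), χ (-ξ₁, ξ') = χ (ξ₁, ξ'))
    (φ : ℝ → ℝ) (hφ : ContDiff ℝ (⊤ : ℕ∞) φ) (hφeven : ∀ s : ℝ, φ (-s) = φ s)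
    (hφ0 : ∀ s : ℝ, |s| ≤ 1 → φ s = 0) (hφ1 : ∀ s : ℝ, 2 ≤ |s| → φ s = 1)
    (a : SchwartzMap (EuclideanSpace ℝ (Fin (d - 1))) ℂ)
    (Q : QuadraticForm ℝ (EuclideanSpace ℝ (Fin (d - 1))))
    (v : ℝ × EuclideanSpace ℝ (Fin (d - 1))) :
    ∃ C : ℝ, ∀ (t : ℝ) (x : ℝ × EuclideanSpace ℝ (Fin (d - 1))) (M : ℝ), 1 ≤ M →
      ‖∫ ξ' : EuclideanSpace ℝ (Fin (d - 1)), ∫ ξ₁ in (-M)..M,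
          (((χ (ξ₁, ξ') * φ ξ₁ : ℝ) : ℂ) * a ξ' / (ξ₁ : ℂ)) *
            Complex.exp (Complex.I *
              ((x.1 * ξ₁ + ⟪x.2, ξ'⟫ + t * (v.1 * ξ₁ + ⟪v.2, ξ'⟫ + Q ξ' / ξ₁) : ℝ) : ℂ))‖
        ≤ C := by
  have hχ1 : ContDiffOn ℝ 1 χ {ξ : ℝ × EuclideanSpace ℝ (Fin (d - 1)) | ξ ≠ 0} :=
    hχ.of_le (by exact_mod_cast le_top)
  obtain ⟨K, hK⟩ := exists_bound_of_homogeneous_zero hχ1.continuousOn hχhom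
  obtain ⟨L, hL⟩ := exists_deriv_bound_of_homogeneous_zero hχ1 hχhom
  obtain ⟨D, hD⟩ := (isCompact_Icc (a := (1 : ℝ)) (b := 2)).exists_bound_of_continuousOn
    hφ.continuous.continuousOn
  have hne (s : ℝ) (hs : s ≠ 0) (y : EuclideanSpace ℝ (Fin (d - 1))) :
      ((s, y) : ℝ × EuclideanSpace ℝ (Fin (d - 1))) ≠ 0 := fun h => hs (congrArg Prod.fst h)
  have hline (y : EuclideanSpace ℝ (Fin (d - 1))) :
      ContDiffOn ℝ 1 (fun s => χ (s, y)) {s | s ≠ 0} :=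
    hχ1.comp (f := fun s : ℝ => (s, y)) (contDiff_id.prodMk contDiff_const).contDiffOn
      fun s hs => hne s hs y
  have hinner (t : ℝ) (x : ℝ × EuclideanSpace ℝ (Fin (d - 1))) (M : ℝ) (hM : 1 ≤ M)
      (y : EuclideanSpace ℝ (Fin (d - 1))) :
      ‖∫ ξ₁ in (-M)..M, (((χ (ξ₁, y) * φ ξ₁ : ℝ) : ℂ) * a y / (ξ₁ : ℂ)) *
          Complex.exp (Complex.I *
            ((x.1 * ξ₁ + ⟪x.2, y⟫ + t * (v.1 * ξ₁ + ⟪v.2, y⟫ + Q y / ξ₁) : ℝ) : ℂ))‖ ≤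
        2 * (K * D + 20 * K) * (‖y‖ ^ 0 * ‖a y‖) + 40 * L * (‖y‖ ^ 1 * ‖a y‖) := by
    have e (s : ℝ) : x.1 * s + ⟪x.2, y⟫ + t * (v.1 * s + ⟪v.2, y⟫ + Q y / s) =
        (x.1 + t * v.1) * s + (⟪x.2, y⟫ + t * ⟪v.2, y⟫) + t * Q y / s := by ring
    simp only [e]
    rw [integral_symm_amplitude_mul_exp (g := fun s => χ (s, y) * φ s)
      ((hline y).continuousOn.mul hφ.continuous.continuousOn)
      (fun s hs => by simp [hφ0 s hs]) (fun s => by rw [hχeven, hφeven]) _ _ _ _ hM]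
    have key := abs_integral_amplitude_mul_sin_le (h := fun s => χ (s, y))
      ((hline y).mono fun s hs => (Set.mem_Ioi.1 hs).ne') (fun s hs => hK _ (hne s hs.ne' y))
      (hL y) hφ.continuous
      (fun s hs => hφ1 s (hs.trans (le_abs_self s))) hD (x.1 + t * v.1) (t * Q y) hM
    rw [norm_mul, norm_mul, norm_mul, norm_mul, Complex.norm_exp_I_mul_ofReal, Complex.norm_I,
      Complex.norm_real, Real.norm_eq_abs, Complex.norm_ofNat]
    have := mul_le_mul_of_nonneg_left key (by positivity : 0 ≤ 2 * ‖a y‖)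
    linarith
  refine ⟨_, fun t x M hM => norm_integral_le_of_norm_le ?_ (.of_forall (hinner t x M hM))⟩
  exact ((a.integrable_pow_mul volume 0).const_mul _).add
    ((a.integrable_pow_mul volume 1).const_mul _)
end

section
/- Let d ≥ 1, m ∈ ℕ and C₁ > 1. There exists a constant C = C(d, m, C₁) such that: for every open set Ω ⊂ ℝ^d, every f : ℝ^d → ℂ of class C^m with compact support contained in Ω, every real-valued φ of class C^{m+1} on Ω satisfying ‖∂^α φ‖_{L^∞(Ω)} ≤ C₁ for all multi-indices α with 1 ≤ |α| ≤ m+1 and |∇φ(x)| ≥ C₁^{-1} for all x ∈ Ω, and every ε > 0, one has |∫_{ℝ^d} e^{i φ(x)/ε} f(x) dx| ≤ C · ε^m · Σ_{|α| ≤ m} ‖∂^α f‖_{L¹(ℝ^d)}. -/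
open MeasureTheory

section NonstationaryPhase

open Set Function

variable {ι E : Type*} [Fintype ι] [NormedAddCommGroup E] [InnerProductSpace ℝ E]

/-- A phase function `φ` of class `C^{n+1}` on the open set `Ω`, whose derivatives of order
`1, …, n+1` are bounded by `C` and whose differential has norm at least `C⁻¹`. -/
structure IsNonstationaryPhase (n : ℕ) (C : ℝ) (Ω : Set E) (φ : E → ℝ) : Prop where
  isOpen : IsOpen Ω
  contDiffOn : ContDiffOn ℝ (n + 1) φ Ω
  norm_le : ∀ i : ℕ, 1 ≤ i → i ≤ n + 1 → ∀ x ∈ Ω, ‖iteratedFDerivWithin ℝ i φ Ω x‖ ≤ C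
  le_norm : ∀ x ∈ Ω, C⁻¹ ≤ ‖fderivWithin ℝ φ Ω x‖

/-- The coordinate `k` of the vector `∇φ / |∇φ|²`, as a function of the differential of `φ`. -/
noncomputable def normalizedCoord (b : OrthonormalBasis ι ℝ E) (k : ι) (w : E →L[ℝ] ℝ) : ℝ :=
  w (b k) / ∑ j, w (b j) ^ 2

/-- The transpose `f ↦ div (f ∇φ / |∇φ|²)` of the operator `(∇φ / |∇φ|²) · ∇`. -/
noncomputable def phaseTranspose (b : OrthonormalBasis ι ℝ E) (φ : E → ℝ) (f : E → ℂ) (x : E) :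
    ℂ :=
  ∑ k, fderiv ℝ (fun y ↦ normalizedCoord b k (fderiv ℝ φ y) • f y) x (b k)

lemma sum_apply_basis_sq_ne_zero (b : OrthonormalBasis ι ℝ E) {w : E →L[ℝ] ℝ} (hw : w ≠ 0) :
    ∑ j, w (b j) ^ 2 ≠ 0 := by
  contrapose! hw
  rw [Finset.sum_eq_zero_iff_of_nonneg fun _ _ ↦ sq_nonneg _] at hw
  have : (w : E →ₗ[ℝ] ℝ) = 0 := b.toBasis.ext fun j ↦ by simpa using hw j (Finset.mem_univ j)
  ext x
  exact LinearMap.congr_fun this x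

lemma sum_normalizedCoord_mul (b : OrthonormalBasis ι ℝ E) {w : E →L[ℝ] ℝ} (hw : w ≠ 0) :
    ∑ k, normalizedCoord b k w * w (b k) = 1 := by
  simp only [normalizedCoord, div_mul_eq_mul_div, ← sq]
  rw [← Finset.sum_div, div_self (sum_apply_basis_sq_ne_zero b hw)]

lemma contDiffOn_normalizedCoord (b : OrthonormalBasis ι ℝ E) (k : ι) {n : WithTop ℕ∞} :
    ContDiffOn ℝ n (normalizedCoord b k) {0}ᶜ := by
  refine ContDiffOn.div (by fun_prop) (by fun_prop) fun w hw ↦ sum_apply_basis_sq_ne_zero b hw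

lemma exists_norm_iteratedFDerivWithin_normalizedCoord_le (b : OrthonormalBasis ι ℝ E) (n : ℕ)
    {C : ℝ} (hC : 0 < C) :
    ∃ M : ℝ, ∀ k, ∀ i ≤ n, ∀ w : E →L[ℝ] ℝ, C⁻¹ ≤ ‖w‖ → ‖w‖ ≤ C →
      ‖iteratedFDerivWithin ℝ i (normalizedCoord b k) {0}ᶜ w‖ ≤ M := by
  have : FiniteDimensional ℝ E := b.toBasis.finiteDimensional_of_finite
  have : ProperSpace (E →L[ℝ] ℝ) := FiniteDimensional.proper_real _
  have hK : IsCompact (Metric.closedBall (0 : E →L[ℝ] ℝ) C ∩ {w | C⁻¹ ≤ ‖w‖}) :=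
    (isCompact_closedBall _ _).inter_right (isClosed_le continuous_const continuous_norm)
  have hsub : Metric.closedBall (0 : E →L[ℝ] ℝ) C ∩ {w | C⁻¹ ≤ ‖w‖} ⊆ {0}ᶜ := fun w hw ↦
    norm_pos_iff.1 ((inv_pos.2 hC).trans_le hw.2)
  have hcont : ContinuousOn (fun w ↦ ∑ k, ∑ i ∈ Finset.range (n + 1),
      ‖iteratedFDerivWithin ℝ i (normalizedCoord b k) {0}ᶜ w‖)
      (Metric.closedBall (0 : E →L[ℝ] ℝ) C ∩ {w | C⁻¹ ≤ ‖w‖}) := by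
    refine continuousOn_finsetSum _ fun k _ ↦ continuousOn_finsetSum _ fun i _ ↦ ?_
    exact (((contDiffOn_normalizedCoord b k).continuousOn_iteratedFDerivWithin (n := i) le_rfl
      isOpen_compl_singleton.uniqueDiffOn).mono hsub).norm
  obtain ⟨M, hM⟩ := hK.exists_bound_of_continuousOn hcont
  refine ⟨M, fun k i hi w h₁ h₂ ↦ ?_⟩
  refine le_trans ?_ ((le_abs_self _).trans (hM w ⟨by simpa using h₂, h₁⟩))
  refine le_trans ?_ (Finset.single_le_sum (fun k _ ↦ Finset.sum_nonneg fun i _ ↦ norm_nonneg _)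
    (Finset.mem_univ k))
  exact Finset.single_le_sum
    (f := fun i ↦ ‖iteratedFDerivWithin ℝ i (normalizedCoord b k) {0}ᶜ w‖)
    (fun i _ ↦ norm_nonneg _) (Finset.mem_range.2 (Nat.lt_succ_of_le hi))

namespace IsNonstationaryPhase

variable {n : ℕ} {C : ℝ} {Ω : Set E} {φ : E → ℝ}

lemma mono {n' : ℕ} (h : IsNonstationaryPhase n C Ω φ) (hn : n' ≤ n) :
    IsNonstationaryPhase n' C Ω φ where
  isOpen := h.isOpen
  contDiffOn := h.contDiffOn.of_le (by exact_mod_cast Nat.succ_le_succ hn)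
  norm_le i h₁ h₂ := h.norm_le i h₁ (by lia)
  le_norm := h.le_norm

lemma contDiffOn_fderiv (h : IsNonstationaryPhase n C Ω φ) : ContDiffOn ℝ n (fderiv ℝ φ) Ω :=
  h.contDiffOn.fderiv_of_isOpen h.isOpen le_rfl

lemma differentiableAt (h : IsNonstationaryPhase n C Ω φ) {x : E} (hx : x ∈ Ω) :
    DifferentiableAt ℝ φ x :=
  (h.contDiffOn.contDiffAt (h.isOpen.mem_nhds hx)).differentiableAt (by simp)

lemma inv_le_norm_fderiv (h : IsNonstationaryPhase n C Ω φ) {x : E} (hx : x ∈ Ω) :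
    C⁻¹ ≤ ‖fderiv ℝ φ x‖ := by
  rw [← fderivWithin_of_isOpen h.isOpen hx]
  exact h.le_norm x hx

lemma fderiv_ne_zero (h : IsNonstationaryPhase n C Ω φ) (hC : 0 < C) {x : E} (hx : x ∈ Ω) :
    fderiv ℝ φ x ≠ 0 :=
  norm_pos_iff.1 ((inv_pos.2 hC).trans_le (h.inv_le_norm_fderiv hx))

lemma norm_iteratedFDerivWithin_fderiv_le (h : IsNonstationaryPhase n C Ω φ) {i : ℕ} (hi : i ≤ n)
    {x : E} (hx : x ∈ Ω) : ‖iteratedFDerivWithin ℝ i (fderiv ℝ φ) Ω x‖ ≤ C := by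
  rw [iteratedFDerivWithin_of_isOpen i h.isOpen hx, norm_iteratedFDeriv_fderiv,
    ← iteratedFDerivWithin_of_isOpen (i + 1) h.isOpen hx]
  exact h.norm_le (i + 1) (by lia) (by lia) x hx

lemma contDiffOn_normalizedCoord_fderiv (h : IsNonstationaryPhase n C Ω φ) (hC : 0 < C)
    (b : OrthonormalBasis ι ℝ E) (k : ι) :
    ContDiffOn ℝ n (fun x ↦ normalizedCoord b k (fderiv ℝ φ x)) Ω :=
  (contDiffOn_normalizedCoord b k).comp h.contDiffOn_fderiv fun _ hx ↦ h.fderiv_ne_zero hC hx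

lemma contDiff_normalizedCoord_smul (h : IsNonstationaryPhase n C Ω φ) (hC : 0 < C)
    (b : OrthonormalBasis ι ℝ E) (k : ι) {f : E → ℂ} (hf : ContDiff ℝ n f)
    (hfΩ : tsupport f ⊆ Ω) :
    ContDiff ℝ n (fun x ↦ normalizedCoord b k (fderiv ℝ φ x) • f x) := by
  refine contDiff_iff_contDiffAt.2 fun x ↦ ?_
  by_cases hx : x ∈ tsupport fun x ↦ normalizedCoord b k (fderiv ℝ φ x) • f x
  swap
  · exact contDiffAt_const.congr_of_eventuallyEq (notMem_tsupport_iff_eventuallyEq.1 hx)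
  have hxΩ : x ∈ Ω := hfΩ (tsupport_smul_subset_right _ f hx)
  exact ((h.contDiffOn_normalizedCoord_fderiv hC b k).contDiffAt
    (h.isOpen.mem_nhds hxΩ)).smul hf.contDiffAt

lemma contDiff_phaseTranspose (h : IsNonstationaryPhase (n + 1) C Ω φ) (hC : 0 < C)
    (b : OrthonormalBasis ι ℝ E) {f : E → ℂ} (hf : ContDiff ℝ (n + 1 : ℕ) f)
    (hfΩ : tsupport f ⊆ Ω) : ContDiff ℝ n (phaseTranspose b φ f) :=
  ContDiff.sum fun k _ ↦ ((h.contDiff_normalizedCoord_smul hC b k hf hfΩ).fderiv_right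
    (by exact_mod_cast le_rfl)).clm_apply contDiff_const

end IsNonstationaryPhase

lemma tsupport_phaseTranspose_subset (b : OrthonormalBasis ι ℝ E) (φ : E → ℝ) (f : E → ℂ) :
    tsupport (phaseTranspose b φ f) ⊆ tsupport f := by
  refine closure_minimal (fun x hx ↦ ?_) (isClosed_tsupport f)
  obtain ⟨k, -, hk⟩ := Finset.exists_ne_zero_of_sum_ne_zero hx
  exact tsupport_smul_subset_right _ f
    (tsupport_fderiv_apply_subset ℝ (b k) (subset_tsupport _ hk))

lemma exists_norm_iteratedFDerivWithin_normalizedCoord_fderiv_le (b : OrthonormalBasis ι ℝ E)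
    (n : ℕ) {C : ℝ} (hC : 1 ≤ C) :
    ∃ B : ℝ, 0 ≤ B ∧ ∀ {Ω : Set E} {φ : E → ℝ}, IsNonstationaryPhase n C Ω φ → ∀ k, ∀ i ≤ n,
      ∀ x ∈ Ω, ‖iteratedFDerivWithin ℝ i (fun y ↦ normalizedCoord b k (fderiv ℝ φ y)) Ω x‖ ≤
        B := by
  have hC₀ : 0 < C := one_pos.trans_le hC
  obtain ⟨M, hM⟩ := exists_norm_iteratedFDerivWithin_normalizedCoord_le b n hC₀
  refine ⟨n.factorial * |M| * C ^ n, by positivity, fun {Ω φ} h k i hi x hx ↦ ?_⟩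
  have hφx : ‖fderiv ℝ φ x‖ ≤ C := by
    simpa using h.norm_iteratedFDerivWithin_fderiv_le (Nat.zero_le n) hx
  refine (norm_iteratedFDerivWithin_comp_le (contDiffOn_normalizedCoord b k) h.contDiffOn_fderiv
    (by exact_mod_cast hi) isOpen_compl_singleton.uniqueDiffOn h.isOpen.uniqueDiffOn
    (fun _ hy ↦ h.fderiv_ne_zero hC₀ hy) hx (C := |M|) (D := C)
    (fun j hj ↦ (hM k j (hj.trans hi) _ (h.inv_le_norm_fderiv hx) hφx).trans (le_abs_self M))
    fun j hj hji ↦ (h.norm_iteratedFDerivWithin_fderiv_le (hji.trans hi) hx).trans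
      (le_self_pow₀ hC (by lia))).trans ?_
  gcongr

/-- The transposed operator loses one derivative, pointwise and uniformly in the phase. -/
lemma exists_norm_iteratedFDeriv_phaseTranspose_le (b : OrthonormalBasis ι ℝ E) (m : ℕ) {C : ℝ}
    (hC : 1 ≤ C) :
    ∃ K : ℝ, 0 ≤ K ∧ ∀ {Ω : Set E} {φ : E → ℝ}, IsNonstationaryPhase (m + 1) C Ω φ →
      ∀ f : E → ℂ, ContDiff ℝ (m + 1 : ℕ) f → tsupport f ⊆ Ω → ∀ i ≤ m, ∀ x,
        ‖iteratedFDeriv ℝ i (phaseTranspose b φ f) x‖ ≤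
          K * ∑ j ∈ Finset.range (m + 2), ‖iteratedFDeriv ℝ j f x‖ := by
  have hC₀ : 0 < C := one_pos.trans_le hC
  obtain ⟨B, hB₀, hB⟩ := exists_norm_iteratedFDerivWithin_normalizedCoord_fderiv_le b (m + 1) hC
  refine ⟨Fintype.card ι * (2 ^ (m + 1) * B), by positivity, fun {Ω φ} h f hf hfΩ i hi x ↦ ?_⟩
  set S := ∑ j ∈ Finset.range (m + 2), ‖iteratedFDeriv ℝ j f x‖
  have hS : 0 ≤ S := Finset.sum_nonneg fun _ _ ↦ norm_nonneg _
  by_cases hx : x ∈ Ω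
  swap
  · have : iteratedFDeriv ℝ i (phaseTranspose b φ f) x = 0 := by
      by_contra h0
      exact hx (hfΩ (tsupport_phaseTranspose_subset b φ f (support_iteratedFDeriv_subset i h0)))
    rw [this, norm_zero]
    positivity
  have hsmul k := h.contDiff_normalizedCoord_smul hC₀ b k hf hfΩ
  have hfd k : ContDiff ℝ m
      (fderiv ℝ fun y ↦ normalizedCoord b k (fderiv ℝ φ y) • f y) :=
    (hsmul k).fderiv_right (by exact_mod_cast le_rfl)
  have hi' : (i : WithTop ℕ∞) ≤ m := by exact_mod_cast hi
  have hterm k : ‖iteratedFDeriv ℝ i (fun x ↦ fderiv ℝ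
      (fun y ↦ normalizedCoord b k (fderiv ℝ φ y) • f y) x (b k)) x‖ ≤ 2 ^ (m + 1) * B * S := by
    refine (norm_iteratedFDeriv_clm_apply_const (hfd k).contDiffAt hi').trans ?_
    rw [b.norm_eq_one, one_mul, norm_iteratedFDeriv_fderiv,
      ← iteratedFDerivWithin_of_isOpen (i + 1) h.isOpen hx]
    refine (norm_iteratedFDerivWithin_smul_le (h.contDiffOn_normalizedCoord_fderiv hC₀ b k)
      hf.contDiffOn h.isOpen.uniqueDiffOn hx (by exact_mod_cast Nat.succ_le_succ hi)).trans ?_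
    calc _ ≤ ∑ j ∈ Finset.range (i + 1 + 1), ((i + 1).choose j : ℝ) * B * S := by
          refine Finset.sum_le_sum fun j hj ↦ ?_
          rw [Finset.mem_range] at hj
          gcongr
          · exact hB h k j (by lia) x hx
          · rw [iteratedFDerivWithin_of_isOpen _ h.isOpen hx]
            exact Finset.single_le_sum (f := fun l ↦ ‖iteratedFDeriv ℝ l f x‖)
              (fun _ _ ↦ norm_nonneg _) (Finset.mem_range.2 (by lia))
      _ = 2 ^ (i + 1) * B * S := by
          rw [← Finset.sum_mul, ← Finset.sum_mul]
          exact_mod_cast congrArg (fun c : ℕ ↦ (c : ℝ) * B * S) (Nat.sum_range_choose (i + 1))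
      _ ≤ 2 ^ (m + 1) * B * S := by
          gcongr
          norm_num
  unfold phaseTranspose
  rw [iteratedFDeriv_fun_sum_apply fun k _ ↦
    (((hfd k).of_le hi').clm_apply contDiff_const).contDiffAt]
  refine (norm_sum_le_of_le _ fun k _ ↦ hterm k).trans_eq ?_
  simp only [Finset.sum_const, Finset.card_univ, nsmul_eq_mul]
  ring

variable [MeasurableSpace E] [BorelSpace E]

lemma integrable_norm_iteratedFDeriv (μ : Measure E) [IsFiniteMeasureOnCompacts μ] {f : E → ℂ}
    {n i : ℕ} (hf : ContDiff ℝ n f) (hfc : HasCompactSupport f) (hi : i ≤ n) :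
    Integrable (fun x ↦ ‖iteratedFDeriv ℝ i f x‖) μ :=
  ((hf.continuous_iteratedFDeriv (by exact_mod_cast hi)).integrable_of_hasCompactSupport
    (hfc.iteratedFDeriv i)).norm

variable [FiniteDimensional ℝ E]

/-- One integration by parts against an oscillating factor. -/
lemma integral_exp_phase_mul_eq {n : ℕ} {C : ℝ} {Ω : Set E} {φ : E → ℝ} (μ : Measure E)
    [μ.IsAddHaarMeasure] (h : IsNonstationaryPhase (n + 1) C Ω φ) (hC : 0 < C)
    (b : OrthonormalBasis ι ℝ E) {f : E → ℂ} (hf : ContDiff ℝ (n + 1 : ℕ) f)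
    (hfc : HasCompactSupport f) (hfΩ : tsupport f ⊆ Ω) {ε : ℝ} (hε : ε ≠ 0) :
    ∫ x, Complex.exp (Complex.I * ((φ x / ε : ℝ) : ℂ)) * f x ∂μ =
      Complex.I * ε *
        ∫ x, Complex.exp (Complex.I * ((φ x / ε : ℝ) : ℂ)) * phaseTranspose b φ f x ∂μ := by
  set e : E → ℂ := fun x ↦ Complex.exp (Complex.I * ((φ x / ε : ℝ) : ℂ)) with he
  have hφcont : ContinuousOn φ Ω := h.contDiffOn.continuousOn
  have hecont : ContinuousOn e Ω := by
    simp only [he]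
    fun_prop
  have hint {g : E → ℂ} (hg : Continuous g) (hgf : tsupport g ⊆ tsupport f) :
      Integrable (fun x ↦ e x * g x) μ := by
    refine Continuous.integrable_of_hasCompactSupport ?_
      (HasCompactSupport.mul_left (hfc.of_isClosed_subset (isClosed_tsupport g) hgf))
    refine continuous_of_tsupport fun x hx ↦ ?_
    exact (hecont.continuousAt (h.isOpen.mem_nhds (hfΩ (hgf (tsupport_mul_subset_right hx))))).mul
      hg.continuousAt
  have hderiv {x : E} (hx : x ∈ Ω) : HasFDerivAt e
      ((Complex.I * e x / ε) • Complex.ofRealCLM.comp (fderiv ℝ φ x)) x := by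
    have h₁ : HasFDerivAt (fun y ↦ ((φ y : ℝ) : ℂ)) (Complex.ofRealCLM.comp (fderiv ℝ φ x)) x :=
      Complex.ofRealCLM.hasFDerivAt.comp x (h.differentiableAt hx).hasFDerivAt
    have h₂ := (h₁.const_mul (Complex.I / ε)).cexp
    have heq : e = fun y ↦ Complex.exp (Complex.I / ε * (φ y : ℂ)) := by
      funext y
      simp only [he]
      congr 1
      push_cast
      ring
    rw [heq]
    refine h₂.congr_fderiv ?_
    rw [smul_smul]
    congr 1
    ring
  set u : ι → E → ℂ := fun k x ↦ normalizedCoord b k (fderiv ℝ φ x) • f x with hu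
  have hu_supp k : tsupport (u k) ⊆ tsupport f := tsupport_smul_subset_right _ f
  have hu_diff k : ContDiff ℝ (n + 1 : ℕ) (u k) := h.contDiff_normalizedCoord_smul hC b k hf hfΩ
  have hdu_int k : Integrable (fun x ↦ e x * fderiv ℝ (u k) x (b k)) μ :=
    hint (((hu_diff k).continuous_fderiv (by simp)).clm_apply continuous_const)
      ((tsupport_fderiv_apply_subset ℝ (b k)).trans (hu_supp k))
  have hde_eq k x : fderiv ℝ e x (b k) * u k x =
      e x * ((Complex.I / ε) * ((fderiv ℝ φ x (b k) * normalizedCoord b k (fderiv ℝ φ x) : ℝ) : ℂ)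
        * f x) := by
    by_cases hx : x ∈ Ω
    · rw [(hderiv hx).fderiv]
      simp [hu]
      ring
    · have : f x = 0 := image_eq_zero_of_notMem_tsupport fun hx' ↦ hx (hfΩ hx')
      simp [hu, this]
  have hde_int k : Integrable (fun x ↦ fderiv ℝ e x (b k) * u k x) μ := by
    simp only [hde_eq]
    refine hint (continuous_of_tsupport fun x hx ↦ ?_) (tsupport_mul_subset_right)
    have hxΩ := h.isOpen.mem_nhds (hfΩ (tsupport_mul_subset_right hx))
    have h₁ := h.contDiffOn_fderiv.continuousOn.continuousAt hxΩ
    have h₂ := (h.contDiffOn_normalizedCoord_fderiv hC b k).continuousOn.continuousAt hxΩ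
    have h₃ : ContinuousAt (fun y ↦ fderiv ℝ φ y (b k)) x := h₁.clm_apply continuousAt_const
    exact (continuousAt_const.mul
      (Complex.continuous_ofReal.continuousAt.comp (h₃.mul h₂))).mul hf.continuous.continuousAt
  have hparts k : ∫ x, e x * fderiv ℝ (u k) x (b k) ∂μ = -∫ x, fderiv ℝ e x (b k) * u k x ∂μ :=
    integral_mul_fderiv_eq_neg_fderiv_mul_of_integrable (hde_int k) (hdu_int k)
      (hint (hu_diff k).continuous (hu_supp k))
      (fun x hx ↦ (hderiv (hfΩ (hu_supp k hx))).differentiableAt)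
      fun x _ ↦ (hu_diff k).differentiable (by simp) x
  have hsum x : ∑ k, fderiv ℝ e x (b k) * u k x = (Complex.I / ε) * (e x * f x) := by
    by_cases hx : x ∈ Ω
    · simp only [hde_eq]
      rw [← Finset.mul_sum, ← Finset.sum_mul, ← Finset.mul_sum, ← Complex.ofReal_sum]
      simp only [mul_comm (fderiv ℝ φ x _),
        sum_normalizedCoord_mul b (h.fderiv_ne_zero hC hx), Complex.ofReal_one]
      ring
    · have : f x = 0 := image_eq_zero_of_notMem_tsupport fun hx' ↦ hx (hfΩ hx')
      simp [hu, this]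
  have key : ∫ x, e x * phaseTranspose b φ f x ∂μ = -((Complex.I / ε) * ∫ x, e x * f x ∂μ) := by
    simp only [phaseTranspose, Finset.mul_sum]
    rw [integral_finsetSum _ fun k _ ↦ hdu_int k, Finset.sum_congr rfl fun k _ ↦ hparts k,
      Finset.sum_neg_distrib, ← integral_finsetSum _ fun k _ ↦ hde_int k, ← integral_const_mul]
    simp only [hsum]
  have hε' : (ε : ℂ) ≠ 0 := by exact_mod_cast hε
  rw [key]
  field_simp
  rw [Complex.I_sq]
  ring

theorem exists_norm_integral_exp_phase_mul_le (b : OrthonormalBasis ι ℝ E) (μ : Measure E)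
    [μ.IsAddHaarMeasure] (m : ℕ) {C₁ : ℝ} (hC₁ : 1 ≤ C₁) :
    ∃ C : ℝ, 0 ≤ C ∧ ∀ {Ω : Set E} {φ : E → ℝ}, IsNonstationaryPhase m C₁ Ω φ →
      ∀ f : E → ℂ, ContDiff ℝ m f → HasCompactSupport f → tsupport f ⊆ Ω → ∀ ε : ℝ, 0 < ε →
        ‖∫ x, Complex.exp (Complex.I * ((φ x / ε : ℝ) : ℂ)) * f x ∂μ‖ ≤
          C * ε ^ m * ∑ i ∈ Finset.range (m + 1), ∫ x, ‖iteratedFDeriv ℝ i f x‖ ∂μ := by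
  induction m with
  | zero =>
    refine ⟨1, zero_le_one, fun {Ω φ} _ f _ _ _ ε _ ↦ ?_⟩
    refine (norm_integral_le_integral_norm _).trans_eq ?_
    simp [Complex.norm_exp]
  | succ m ih =>
    obtain ⟨C, hC, hmain⟩ := ih
    obtain ⟨K, hK, hbound⟩ := exists_norm_iteratedFDeriv_phaseTranspose_le b m hC₁
    refine ⟨C * ((m + 1) * K), by positivity, fun {Ω φ} h f hf hfc hfΩ ε hε ↦ ?_⟩
    have hC₀ : 0 < C₁ := one_pos.trans_le hC₁
    have hTf := h.contDiff_phaseTranspose hC₀ b hf hfΩ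
    have hsupp := tsupport_phaseTranspose_subset b φ f
    have hTfc : HasCompactSupport (phaseTranspose b φ f) :=
      hfc.of_isClosed_subset (isClosed_tsupport _) hsupp
    have hsum : ∑ i ∈ Finset.range (m + 1), ∫ x, ‖iteratedFDeriv ℝ i (phaseTranspose b φ f) x‖ ∂μ ≤
        (m + 1) * K * ∑ j ∈ Finset.range (m + 1 + 1), ∫ x, ‖iteratedFDeriv ℝ j f x‖ ∂μ := by
      have hj {j : ℕ} (hj : j ∈ Finset.range (m + 1 + 1)) :
          Integrable (fun x ↦ ‖iteratedFDeriv ℝ j f x‖) μ :=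
        integrable_norm_iteratedFDeriv μ hf hfc (Finset.mem_range_succ_iff.1 hj)
      rw [← integral_finsetSum _ fun j ↦ hj]
      refine (Finset.sum_le_card_nsmul _ _
        (K * ∫ x, ∑ j ∈ Finset.range (m + 1 + 1), ‖iteratedFDeriv ℝ j f x‖ ∂μ)
        fun i hi ↦ ?_).trans_eq (by simp [mul_assoc])
      rw [Finset.mem_range_succ_iff] at hi
      rw [← integral_const_mul]
      exact integral_mono (integrable_norm_iteratedFDeriv μ hTf hTfc hi)
        ((integrable_finsetSum _ fun j ↦ hj).const_mul K) (hbound h f hf hfΩ i hi)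
    rw [integral_exp_phase_mul_eq μ h hC₀ b hf hfc hfΩ hε.ne', norm_mul, norm_mul, Complex.norm_I,
      one_mul, Complex.norm_real, Real.norm_of_nonneg hε.le]
    calc _ ≤ ε * (C * ε ^ m * ((m + 1) * K *
          ∑ j ∈ Finset.range (m + 1 + 1), ∫ x, ‖iteratedFDeriv ℝ j f x‖ ∂μ)) := by
          gcongr
          refine (hmain (h.mono m.le_succ) _ hTf hTfc (hsupp.trans hfΩ) ε hε).trans ?_
          gcongr
      _ = _ := by ring

end NonstationaryPhase

/-- Lemma of nonstationary phase: for `d ≥ 1`, `m ∈ ℕ`, `C₁ > 1`, there is `C` such that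
for every open `Ω ⊆ ℝ^d`, every `C^m` function `f` compactly supported in `Ω`, every
real `C^{m+1}` phase `φ` on `Ω` whose derivatives of order `1, …, m+1` are bounded by `C₁`
and whose gradient has norm at least `C₁⁻¹` on `Ω`, and every `ε > 0`,
`|∫ e^{iφ/ε} f| ≤ C ε^m Σ_{i ≤ m} ‖D^i f‖_{L¹}`. -/
theorem nonstationary_phase (d : ℕ) (hd : 1 ≤ d) (m : ℕ) (C₁ : ℝ) (hC₁ : 1 < C₁) :
    ∃ C : ℝ, ∀ Ω : Set (EuclideanSpace ℝ (Fin d)), IsOpen Ω →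
      ∀ f : EuclideanSpace ℝ (Fin d) → ℂ, ContDiff ℝ m f → HasCompactSupport f →
        tsupport f ⊆ Ω →
      ∀ φ : EuclideanSpace ℝ (Fin d) → ℝ, ContDiffOn ℝ (m + 1) φ Ω →
        (∀ i : ℕ, 1 ≤ i → i ≤ m + 1 → ∀ x ∈ Ω, ‖iteratedFDerivWithin ℝ i φ Ω x‖ ≤ C₁) →
        (∀ x ∈ Ω, C₁⁻¹ ≤ ‖fderivWithin ℝ φ Ω x‖) →
      ∀ ε : ℝ, 0 < ε →
        ‖∫ x, Complex.exp (Complex.I * ((φ x / ε : ℝ) : ℂ)) * f x‖ ≤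
          C * ε ^ m * ∑ i ∈ Finset.range (m + 1), ∫ x, ‖iteratedFDeriv ℝ i f x‖ := by
  obtain ⟨C, -, hC⟩ := exists_norm_integral_exp_phase_mul_le
    (EuclideanSpace.basisFun (Fin d) ℝ) volume m hC₁.le
  exact ⟨C, fun Ω hΩ f hf hfc hfΩ φ hφ hφ_le hφ_ge ε hε ↦
    hC ⟨hΩ, hφ, hφ_le, hφ_ge⟩ f hf hfc hfΩ ε hε⟩
end

section
/- Let k ≥ 1 and d ≥ 2. Let A₁, …, A_d, π and Q be k×k complex matrices satisfying π² = π, A₁π = 0, πA₁ = 0, Q·A₁ = I − π, and A₁·Q = I − π. Assume there is w ∈ ℝ^{d−1} with π·A_{j+1}·π = w_j·π for every 1 ≤ j ≤ d−1. Let (F_n)_{n∈ℕ} be a sequence of smooth functions ℝ × ℝ^{d−1} → ℂ^k with F_n(t, x') = 0 whenever t ≤ 0. Then there exists a unique sequence (J_n)_{n∈ℕ} of smooth functions ℝ × ℝ^{d−1} → ℂ^k, each vanishing for t ≤ 0, such that A₁·J_0 = 0 and, for every n ∈ ℕ, A₁·J_{n+1} + ∂_t J_n + Σ_{j=1}^{d−1}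 A_{j+1}·∂_{x'_j} J_n = F_n. -/
open MeasureTheory Set Filter Topology
open scoped ContDiff

section ParametricIntegral

universe u

variable {H : Type u} [NormedAddCommGroup H] [NormedSpace ℝ H] [ProperSpace H]

/-- Differentiation under the integral sign for an integrand with continuous derivative. -/
theorem hasFDerivAt_intervalIntegral_of_contDiff {V : Type*} [NormedAddCommGroup V]
    [NormedSpace ℝ V] {f : H × ℝ → V} (hf : ContDiff ℝ 1 f) (a b : ℝ) (x : H) :
    HasFDerivAt (fun y => ∫ s in a..b, f (y, s))
      (∫ s in a..b, (fderiv ℝ f (x, s)).comp (ContinuousLinearMap.inl ℝ H ℝ)) x := by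
  have hcont : Continuous fun q : H × ℝ =>
      (fderiv ℝ f q).comp (ContinuousLinearMap.inl ℝ H ℝ) :=
    (hf.continuous_fderiv one_ne_zero).clm_comp continuous_const
  obtain ⟨C, hC⟩ := ((isCompact_closedBall x 1).prod
    (isCompact_uIcc (a := a) (b := b))).exists_bound_of_continuousOn hcont.continuousOn
  refine intervalIntegral.hasFDerivAt_integral_of_dominated_of_fderiv_le
    (F := fun y s => f (y, s))
    (F' := fun y s => (fderiv ℝ f (y, s)).comp (ContinuousLinearMap.inl ℝ H ℝ))
    (bound := fun _ => C) (Metric.closedBall_mem_nhds x one_pos) ?_ ?_ ?_ ?_ ?_ ?_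
  · exact Eventually.of_forall fun y =>
      (hf.continuous.comp (Continuous.prodMk_right y)).aestronglyMeasurable
  · exact (hf.continuous.comp (Continuous.prodMk_right x)).intervalIntegrable _ _
  · exact (hcont.comp (Continuous.prodMk_right x)).aestronglyMeasurable
  · exact Eventually.of_forall fun s hs y hy => hC (y, s) ⟨hy, uIoc_subset_uIcc hs⟩
  · exact intervalIntegrable_const
  · exact Eventually.of_forall fun s _ y _ =>
      ((hf.differentiable one_ne_zero).differentiableAt.hasFDerivAt).comp y
        (hasFDerivAt_prodMk_left y s)

/-- A parametric integral over a compact interval inherits the regularity of its integrand. -/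
theorem ContDiff.intervalIntegral_parametric {V : Type u} [NormedAddCommGroup V]
    [NormedSpace ℝ V] {n : ℕ} {f : H × ℝ → V} (hf : ContDiff ℝ n f) (a b : ℝ) :
    ContDiff ℝ n fun y => ∫ s in a..b, f (y, s) := by
  induction n generalizing V with
  | zero =>
    exact contDiff_zero.2
      (intervalIntegral.continuous_parametric_intervalIntegral_of_continuous'
        (f := fun y s => f (y, s)) (contDiff_zero.1 hf) a b)
  | succ n ih =>
    have hf1 : ContDiff ℝ 1 f := hf.of_le (by exact_mod_cast Nat.le_add_left 1 n)
    have hd := hasFDerivAt_intervalIntegral_of_contDiff hf1 a b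
    rw [Nat.cast_add, Nat.cast_one, contDiff_succ_iff_fderiv]
    refine ⟨fun x => (hd x).differentiableAt, by simp, ?_⟩
    rw [funext fun x => (hd x).fderiv]
    exact ih ((hf.fderiv_right (by norm_cast)).clm_comp contDiff_const)

theorem ContDiff.intervalIntegral_parametric_infty {V : Type u} [NormedAddCommGroup V]
    [NormedSpace ℝ V] {f : H × ℝ → V} (hf : ContDiff ℝ ∞ f) (a b : ℝ) :
    ContDiff ℝ ∞ fun y => ∫ s in a..b, f (y, s) :=
  contDiff_infty.2 fun n => (contDiff_infty.1 hf n).intervalIntegral_parametric a b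

end ParametricIntegral

section Causal

variable {E V W : Type} [NormedAddCommGroup E] [NormedSpace ℝ E] [NormedAddCommGroup V]
  [NormedSpace ℝ V] [NormedAddCommGroup W] [NormedSpace ℝ W]

/-- Smooth functions vanishing where the time function `τ` is nonpositive. -/
def IsCausal (τ : E →L[ℝ] ℝ) (f : E → V) : Prop :=
  ContDiff ℝ ∞ f ∧ ∀ p, τ p ≤ 0 → f p = 0

namespace IsCausal

variable {τ : E →L[ℝ] ℝ} {f g : E → V} {a : E}

theorem zero : IsCausal τ (fun _ => 0 : E → V) := ⟨contDiff_const, fun _ _ => rfl⟩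

theorem add (hf : IsCausal τ f) (hg : IsCausal τ g) : IsCausal τ fun p => f p + g p :=
  ⟨hf.1.add hg.1, fun p hp => by simp [hf.2 p hp, hg.2 p hp]⟩

theorem sub (hf : IsCausal τ f) (hg : IsCausal τ g) : IsCausal τ fun p => f p - g p :=
  ⟨hf.1.sub hg.1, fun p hp => by simp [hf.2 p hp, hg.2 p hp]⟩

theorem clm (hf : IsCausal τ f) (M : V →L[ℝ] W) : IsCausal τ fun p => M (f p) :=
  ⟨M.contDiff.comp hf.1, fun p hp => by simp [hf.2 p hp]⟩

theorem differentiable (hf : IsCausal τ f) : Differentiable ℝ f :=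
  hf.1.differentiable (by simp)

protected theorem fderiv (hf : IsCausal τ f) (ha : τ a = 1) : IsCausal τ (fderiv ℝ f) := by
  have hs : ContDiff ℝ ∞ (_root_.fderiv ℝ f) := hf.1.fderiv_right (by simp)
  refine ⟨hs, fun p hp => ?_⟩
  have hlim : Tendsto (fun ε : ℝ => _root_.fderiv ℝ f (p - ε • a)) (𝓝[>] 0)
      (𝓝 (_root_.fderiv ℝ f p)) := by
    have h : Continuous fun ε : ℝ => _root_.fderiv ℝ f (p - ε • a) :=
      hs.continuous.comp (by fun_prop)
    simpa using (h.tendsto 0).mono_left nhdsWithin_le_nhds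
  refine tendsto_nhds_unique (hlim.congr' ?_) tendsto_const_nhds
  filter_upwards [self_mem_nhdsWithin] with ε hε
  have hε0 : (0 : ℝ) < ε := hε
  have hneg : ∀ᶠ q in 𝓝 (p - ε • a), τ q < 0 :=
    τ.continuous.continuousAt.eventually_lt_const (by simp [ha]; linarith)
  have h0 : f =ᶠ[𝓝 (p - ε • a)] fun _ => 0 := hneg.mono fun q hq => hf.2 q hq.le
  rw [h0.fderiv_eq]
  simp

end IsCausal

variable {τ : E →L[ℝ] ℝ} {a : E}

/-- A causal function constant along a direction transverse to the time slices is zero. -/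
theorem IsCausal.eq_zero_of_fderiv_apply_eq_zero {f : E → V} (hf : IsCausal τ f)
    (ha : τ a = 1) (h : ∀ p, fderiv ℝ f p a = 0) (p : E) : f p = 0 := by
  have hd : ∀ r : ℝ, HasDerivAt (fun r : ℝ => f (p + r • a)) 0 r := fun r => by
    have hl : HasDerivAt (fun r : ℝ => p + r • a) a r := by
      simpa using ((hasDerivAt_id r).smul_const a).const_add p
    rw [← h (p + r • a)]
    exact (hf.differentiable (p + r • a)).hasFDerivAt.comp_hasDerivAt r hl
  have hconst := is_const_of_deriv_eq_zero (fun r => (hd r).differentiableAt) (fun r => (hd r).deriv)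
    0 (-τ p)
  simp only [zero_smul, add_zero] at hconst
  exact hconst.trans (hf.2 _ (by simp [ha]))

/-- Duhamel's formula: the transport equation `∂_a v = S` has a causal solution for every
causal source. -/
theorem IsCausal.exists_fderiv_apply_eq [ProperSpace E] [CompleteSpace V] {S : E → V}
    (hS : IsCausal τ S) (ha : τ a = 1) :
    ∃ v : E → V, IsCausal τ v ∧ ∀ p, fderiv ℝ v p a = S p := by
  let v : E → V := fun p => τ p • ∫ θ in (0 : ℝ)..1, S (p + (τ p * θ - τ p) • a)
  have hv : ∀ p, v p = ∫ s in (0 : ℝ)..τ p, S (p + (s - τ p) • a) := fun p => by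
    simpa using intervalIntegral.smul_integral_comp_mul_left (a := 0) (b := 1)
      (fun s => S (p + (s - τ p) • a)) (τ p)
  have hvs : ContDiff ℝ ∞ v := by
    refine τ.contDiff.smul (ContDiff.intervalIntegral_parametric_infty
      (f := fun q : E × ℝ => S (q.1 + (τ q.1 * q.2 - τ q.1) • a)) (hS.1.comp ?_) 0 1)
    fun_prop
  refine ⟨v, ⟨hvs, fun p hp => ?_⟩, fun p => ?_⟩
  · rw [hv, intervalIntegral.integral_congr (g := fun _ => 0)]
    · simp
    · intro s hs
      rw [uIcc_of_ge hp] at hs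
      exact hS.2 _ (by simpa [ha] using hs.2)
  · have hl : HasDerivAt (fun r : ℝ => p + r • a) a 0 := by
      simpa using ((hasDerivAt_id (0 : ℝ)).smul_const a).const_add p
    have hp0 : p + (0 : ℝ) • a = p := by simp
    have h1 : HasDerivAt (fun r : ℝ => v (p + r • a)) (fderiv ℝ v p a) 0 := by
      have := ((hvs.differentiable (by simp)) (p + (0 : ℝ) • a)).hasFDerivAt.comp_hasDerivAt
        (0 : ℝ) hl
      rwa [hp0] at this
    have hc : Continuous fun s : ℝ => S (p + (s - τ p) • a) :=
      hS.1.continuous.comp (by fun_prop)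
    have h2 : HasDerivAt (fun r : ℝ => v (p + r • a)) (S p) 0 := by
      have hline : (fun r : ℝ => v (p + r • a)) =
          fun r => ∫ s in (0 : ℝ)..τ p + r, S (p + (s - τ p) • a) := by
        funext r
        rw [hv]
        have : ∀ s : ℝ, p + r • a + (s - τ (p + r • a)) • a = p + (s - τ p) • a := fun s => by
          simp only [map_add, map_smul, ha, smul_eq_mul, mul_one]
          module
        simp only [this]
        simp [ha]
      rw [hline]
      have hi := hc.integral_hasStrictDerivAt 0 (τ p + 0)
      simpa using hi.hasDerivAt.comp_const_add (τ p) 0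
    exact h1.unique h2

/-- One step of the recursion: the component of `J` in the range of `A` is prescribed
algebraically, its component in the range of `P` by a transport equation. -/
theorem existsUnique_causal_step [ProperSpace E] [CompleteSpace V] (ha : τ a = 1)
    {A P Q : V →L[ℝ] V} {Λ : (E →L[ℝ] V) →L[ℝ] V}
    (hP : ∀ x, P (P x) = P x) (hAP : ∀ x, A (P x) = 0)
    (hQA : ∀ x, Q (A x) = x - P x) (hAQ : ∀ x, A (Q x) = x - P x)
    (hΛ : ∀ T : E →L[ℝ] V, P (Λ (P.comp T)) = P (T a))
    {R F : E → V} (hR : IsCausal τ R) (hPR : ∀ p, P (R p) = 0) (hF : IsCausal τ F) :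
    ∃! J : E → V, IsCausal τ J ∧ (∀ p, A (J p) = R p) ∧
      ∀ p, P (F p - Λ (fderiv ℝ J p)) = 0 := by
  have hcomp : ∀ (M : V →L[ℝ] V) {f : E → V}, IsCausal τ f → ∀ p,
      fderiv ℝ (fun q => M (f q)) p = M.comp (fderiv ℝ f p) := fun M f hf p =>
    (M.hasFDerivAt.comp p (hf.differentiable p).hasFDerivAt).fderiv
  refine existsUnique_of_exists_of_unique ?_ ?_
  · have hg : IsCausal τ fun p => Q (R p) := hR.clm Q
    obtain ⟨v, hv, hve⟩ := ((hF.sub ((hg.fderiv ha).clm Λ)).clm P).exists_fderiv_apply_eq ha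
    refine ⟨fun p => Q (R p) + P (v p), hg.add (hv.clm P), fun p => ?_, fun p => ?_⟩
    · simp [hAQ, hAP, hPR]
    · rw [fderiv_fun_add (hg.differentiable p) ((hv.clm P).differentiable p), hcomp P hv,
        map_add, ← sub_sub, map_sub P, hΛ, hve, hP, sub_self]
  · rintro J J' ⟨hJ, hAJ, hLJ⟩ ⟨hJ', hAJ', hLJ'⟩
    have hD := hJ.sub hJ'
    have hPD : ∀ p, P (J p - J' p) = J p - J' p := fun p => by
      have := hQA (J p - J' p)
      rw [map_sub A, hAJ, hAJ', sub_self, map_zero, eq_comm, sub_eq_zero] at this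
      exact this.symm
    have hder : ∀ p, P.comp (fderiv ℝ (fun q => J q - J' q) p) =
        fderiv ℝ (fun q => J q - J' q) p := fun p => by
      rw [← hcomp P hD p]
      simp only [hPD]
    funext p
    refine sub_eq_zero.1 (hD.eq_zero_of_fderiv_apply_eq_zero ha (fun p => ?_) p)
    have h1 := hΛ (fderiv ℝ (fun q => J q - J' q) p)
    have h2 := congrArg (fun T : E →L[ℝ] V => T a) (hder p)
    simp only [ContinuousLinearMap.comp_apply] at h2
    rw [hder, h2, fderiv_fun_sub (hJ.differentiable p) (hJ'.differentiable p)] at h1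
    rw [fderiv_fun_sub (hJ.differentiable p) (hJ'.differentiable p), ← h1]
    have h3 := hLJ p
    have h4 := hLJ' p
    rw [map_sub, sub_eq_zero] at h3 h4
    rw [map_sub, map_sub, ← h3, ← h4, sub_self]

/-- Unique solvability of the recursive system `A J₀ = 0`, `A Jₙ₊₁ + Λ (D Jₙ) = Fₙ` among
causal functions. -/
theorem existsUnique_causal_seq [ProperSpace E] [CompleteSpace V] (ha : τ a = 1)
    {A P Q : V →L[ℝ] V} {Λ : (E →L[ℝ] V) →L[ℝ] V}
    (hP : ∀ x, P (P x) = P x) (hAP : ∀ x, A (P x) = 0) (hPA : ∀ x, P (A x) = 0)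
    (hQA : ∀ x, Q (A x) = x - P x) (hAQ : ∀ x, A (Q x) = x - P x)
    (hΛ : ∀ T : E →L[ℝ] V, P (Λ (P.comp T)) = P (T a))
    {F : ℕ → E → V} (hF : ∀ n, IsCausal τ (F n)) :
    ∃! J : ℕ → E → V, (∀ n, IsCausal τ (J n)) ∧ (∀ p, A (J 0 p) = 0) ∧
      ∀ n p, A (J (n + 1) p) + Λ (fderiv ℝ (J n) p) = F n p := by
  have step (n : ℕ) (R : {R : E → V // IsCausal τ R ∧ ∀ p, P (R p) = 0}) :=
    existsUnique_causal_step ha hP hAP hQA hAQ hΛ R.2.1 R.2.2 (hF n)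
  choose sol hsol _ using step
  let R : ℕ → {R : E → V // IsCausal τ R ∧ ∀ p, P (R p) = 0} := fun n =>
    Nat.rec ⟨fun _ => 0, IsCausal.zero, fun _ => map_zero P⟩
      (fun n R => ⟨fun p => F n p - Λ (fderiv ℝ (sol n R) p),
        (hF n).sub (((hsol n R).1.fderiv ha).clm Λ), (hsol n R).2.2⟩) n
  refine existsUnique_of_exists_of_unique ⟨fun n => sol n (R n), fun n => (hsol n (R n)).1,
    (hsol 0 (R 0)).2.1, fun n p => ?_⟩ ?_
  · rw [(hsol (n + 1) (R (n + 1))).2.1 p]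
    exact sub_add_cancel _ _
  · have hproj : ∀ J : ℕ → E → V, (∀ n p, A (J (n + 1) p) + Λ (fderiv ℝ (J n) p) = F n p) →
        ∀ n p, P (F n p - Λ (fderiv ℝ (J n) p)) = 0 := fun J hJ n p => by
      rw [← hJ, add_sub_cancel_right, hPA]
    rintro J J' ⟨hJ, hJ0, hJr⟩ ⟨hJ', hJ0', hJr'⟩
    funext n
    induction n with
    | zero =>
      exact (existsUnique_causal_step ha hP hAP hQA hAQ hΛ IsCausal.zero
        (fun _ => map_zero P) (hF 0)).unique ⟨hJ 0, hJ0, hproj J hJr 0⟩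
        ⟨hJ' 0, hJ0', hproj J' hJr' 0⟩
    | succ n ih =>
      refine (existsUnique_causal_step ha hP hAP hQA hAQ hΛ
        ((hF n).sub (((hJ n).fderiv ha).clm Λ)) (hproj J hJr n) (hF (n + 1))).unique
        ⟨hJ (n + 1), fun p => eq_sub_of_add_eq (hJr n p), hproj J hJr (n + 1)⟩
        ⟨hJ' (n + 1), fun p => eq_sub_of_add_eq ?_, hproj J' hJr' (n + 1)⟩
      rw [ih]
      exact hJr' n p

end Causal

/-- Multiplication by a complex matrix as a real continuous linear map. -/
noncomputable def Matrix.mulVecRealCLM {k : ℕ} (M : Matrix (Fin k) (Fin k) ℂ) :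
    (Fin k → ℂ) →L[ℝ] (Fin k → ℂ) :=
  (M.mulVecLin.restrictScalars ℝ).toContinuousLinearMap

@[simp]
theorem Matrix.mulVecRealCLM_apply {k : ℕ} (M : Matrix (Fin k) (Fin k) ℂ) (x : Fin k → ℂ) :
    M.mulVecRealCLM x = M.mulVec x := rfl

/-- Unique determination of the jumps across the characteristic hyperplane (Proposition A.1):
with `π` the spectral projection onto `ker A₁`, `Q` the partial inverse of `A₁`, and the
transport identity `π A_{j+1} π = w_j π`, for every sequence of smooth sources `F_n`
vanishing in `t ≤ 0` there is a unique sequence of smooth jumps `J_n` vanishing in `t ≤ 0`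
with `A₁ J₀ = 0` and `A₁ J_{n+1} + ∂_t J_n + Σ_j A_{j+1} ∂_{x'_j} J_n = F_n`. -/
theorem jumps_uniquely_determined (k d : ℕ) (hk : 1 ≤ k) (hd : 2 ≤ d)
    (A1 : Matrix (Fin k) (Fin k) ℂ) (A' : Fin (d - 1) → Matrix (Fin k) (Fin k) ℂ)
    (π Q : Matrix (Fin k) (Fin k) ℂ)
    (hπ : π * π = π) (hA1π : A1 * π = 0) (hπA1 : π * A1 = 0)
    (hQA1 : Q * A1 = 1 - π) (hA1Q : A1 * Q = 1 - π)
    (w : Fin (d - 1) → ℝ) (hw : ∀ j, π * A' j * π = (w j : ℂ) • π)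
    (F : ℕ → ℝ × EuclideanSpace ℝ (Fin (d - 1)) → Fin k → ℂ)
    (hFsmooth : ∀ n, ContDiff ℝ (⊤ : ℕ∞) (F n))
    (hF0 : ∀ (n : ℕ) (t : ℝ) (x' : EuclideanSpace ℝ (Fin (d - 1))), t ≤ 0 → F n (t, x') = 0) :
    ∃! J : ℕ → ℝ × EuclideanSpace ℝ (Fin (d - 1)) → Fin k → ℂ,
      (∀ n, ContDiff ℝ (⊤ : ℕ∞) (J n)) ∧
      (∀ (n : ℕ) (t : ℝ) (x' : EuclideanSpace ℝ (Fin (d - 1))), t ≤ 0 → J n (t, x') = 0) ∧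
      (∀ p : ℝ × EuclideanSpace ℝ (Fin (d - 1)), A1.mulVec (J 0 p) = 0) ∧
      (∀ (n : ℕ) (p : ℝ × EuclideanSpace ℝ (Fin (d - 1))),
        A1.mulVec (J (n + 1) p) + fderiv ℝ (J n) p (1, 0) +
          ∑ j : Fin (d - 1),
            (A' j).mulVec (fderiv ℝ (J n) p (0, EuclideanSpace.single j 1)) = F n p) := by
  let E := ℝ × EuclideanSpace ℝ (Fin (d - 1))
  let V := Fin k → ℂ
  let ev (u : E) : (E →L[ℝ] V) →L[ℝ] V := ContinuousLinearMap.apply ℝ V u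
  let Λ : (E →L[ℝ] V) →L[ℝ] V := ev (1, 0) +
    ∑ j, (A' j).mulVecRealCLM.comp (ev (0, EuclideanSpace.single j 1))
  have hΛ_apply : ∀ T : E →L[ℝ] V, Λ T = T (1, 0) +
      ∑ j, (A' j).mulVec (T (0, EuclideanSpace.single j 1)) := fun T => by
    simp [Λ, ev]
  let τ : E →L[ℝ] ℝ := ContinuousLinearMap.fst ℝ ℝ _
  let a : E := (1, 0) + ∑ j, w j • ((0, EuclideanSpace.single j 1) : E)
  have hτ : ∀ p : E, τ p = p.1 := fun _ => rfl
  have ha : τ a = 1 := by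
    simp only [a, map_add, map_sum, map_smul]
    simp only [hτ]
    simp
  have hmul : ∀ (M N : Matrix (Fin k) (Fin k) ℂ) (x : V),
      M.mulVec (N.mulVec x) = (M * N).mulVec x := fun M N x => Matrix.mulVec_mulVec x M N
  have hΛ : ∀ T : E →L[ℝ] V,
      π.mulVecRealCLM (Λ (π.mulVecRealCLM.comp T)) = π.mulVecRealCLM (T a) := fun T => by
    have hsmul : ∀ (r : ℝ) (x : V), ((r : ℂ) • π).mulVec x = r • π.mulVec x := fun r x => by
      rw [Matrix.smul_mulVec, Complex.coe_smul]
    have hterm : ∀ (j : Fin (d - 1)) (x : V),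
        π.mulVec ((A' j).mulVec (π.mulVec x)) = w j • π.mulVec x := fun j x => by
      rw [hmul, hmul, hw, hsmul]
    rw [hΛ_apply]
    simp only [a, map_add, map_sum, map_smul, ContinuousLinearMap.comp_apply]
    simp only [Matrix.mulVecRealCLM_apply, hterm]
    rw [hmul, hπ]
  have causal_iff : ∀ f : E → V, IsCausal τ f ↔ ContDiff ℝ (⊤ : ℕ∞) f ∧
      ∀ (t : ℝ) (x' : EuclideanSpace ℝ (Fin (d - 1))), t ≤ 0 → f (t, x') = 0 := fun f =>
    and_congr_right fun _ => Prod.forall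
  have key := existsUnique_causal_seq (τ := τ) ha (A := A1.mulVecRealCLM)
    (P := π.mulVecRealCLM) (Q := Q.mulVecRealCLM) (Λ := Λ)
    (fun x => by simp [hπ]) (fun x => by simp [hA1π]) (fun x => by simp [hπA1])
    (fun x => by simp [hQA1, Matrix.sub_mulVec]) (fun x => by simp [hA1Q, Matrix.sub_mulVec])
    hΛ (F := F) (fun n => (causal_iff _).2 ⟨hFsmooth n, hF0 n⟩)
  simpa only [causal_iff, forall_and, and_assoc, hΛ_apply, Matrix.mulVecRealCLM_apply,
    ← add_assoc] using key
end
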